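/- arXiv:1706.06055 — 2 statements merged into one kernel-verified Lean document; each statement's English description precedes it below -/
import Mathlib

section
/- There exists ω₀ > 0 such that for every ω > ω₀ the system dx/dt = (A₀ + ω⁻¹B₀)x + Σ_{1≤|l|≤m}(B_l x + d_l)e^{ilωt} + d₀ has exactly one (2π/ω)-periodic continuously differentiable solution x : ℝ → ℂⁿ. -/
open Matrix Finset

/-- algebraic lower bound -/
lemma alg_bound {n : ℕ} (A₀ A₁ : (Fin n → ℂ) →L[ℂ] (Fin n → ℂ))
    (h : ∀ y, y ≠ 0 → A₀ y = 0 → ∀ x, A₀ x + A₁ y ≠ 0) :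
    ∃ c > 0, ∃ ε₀ > 0, ∀ ε : ℝ, 0 < ε → ε < ε₀ → ∀ y, c * ε * ‖y‖ ≤ ‖A₀ y + (ε : ℂ) • A₁ y‖ := by
  by_contra hcon
  push Not at hcon
  have H : ∀ k : ℕ, ∃ ε : ℝ, ∃ y : Fin n → ℂ, 0 < ε ∧ ε < 1 / ((k : ℝ) + 1) ∧ ‖y‖ = 1 ∧
      ‖A₀ y + (ε : ℂ) • A₁ y‖ < 1 / ((k : ℝ) + 1) * ε := by
    intro k
    have hk : (0 : ℝ) < 1 / ((k : ℝ) + 1) := by positivity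
    obtain ⟨ε, h1, h2, y, hy⟩ := hcon _ hk _ hk
    have hy0 : y ≠ 0 := by
      rintro rfl
      simp at hy
    have hn : 0 < ‖y‖ := norm_pos_iff.2 hy0
    refine ⟨ε, ((‖y‖⁻¹ : ℝ) : ℂ) • y, h1, h2, ?_, ?_⟩
    · rw [norm_smul]
      simp [hn.ne']
    · rw [map_smul, map_smul, smul_comm, ← smul_add, norm_smul]
      simp only [Complex.norm_real, norm_inv, norm_norm]
      rw [inv_mul_lt_iff₀ hn]
      linarith
  choose ε y h0 h1 h2 h3 using H
  have hk0 := tendsto_one_div_add_atTop_nhds_zero_nat (𝕜 := ℝ)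
  obtain ⟨y0, hy0, φ, hφ, hlim⟩ := (isCompact_sphere (0 : Fin n → ℂ) 1).tendsto_subseq
    (x := y) (fun k => by simp [h2 k])
  have hε : Filter.Tendsto (fun k => (ε (φ k) : ℂ)) Filter.atTop (nhds 0) := by
    have : Filter.Tendsto ε Filter.atTop (nhds 0) :=
      squeeze_zero (fun k => (h0 k).le) (fun k => (h1 k).le) hk0
    have := (Complex.continuous_ofReal.tendsto 0).comp (this.comp hφ.tendsto_atTop)
    rw [Complex.ofReal_zero] at this
    exact this
  have hA1 : Filter.Tendsto (fun k => A₁ (y (φ k))) Filter.atTop (nhds (A₁ y0)) :=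
    (A₁.continuous.tendsto _).comp hlim
  have hA0 : Filter.Tendsto (fun k => A₀ (y (φ k))) Filter.atTop (nhds (A₀ y0)) :=
    (A₀.continuous.tendsto _).comp hlim
  -- scaled remainder
  have hr : Filter.Tendsto (fun k => A₀ (((ε (φ k) : ℂ))⁻¹ • y (φ k)) + A₁ (y (φ k)))
      Filter.atTop (nhds 0) := by
    apply squeeze_zero_norm (a := fun k => 1 / (((φ k : ℕ) : ℝ) + 1)) _
      (hk0.comp hφ.tendsto_atTop)
    intro k
    have he := h0 (φ k)
    have hne : (ε (φ k) : ℂ) ≠ 0 := by exact_mod_cast he.ne'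
    have e : A₀ (((ε (φ k) : ℂ))⁻¹ • y (φ k)) + A₁ (y (φ k)) =
        ((ε (φ k) : ℂ))⁻¹ • (A₀ (y (φ k)) + (ε (φ k) : ℂ) • A₁ (y (φ k))) := by
      rw [smul_add, smul_smul, inv_mul_cancel₀ hne, one_smul, map_smul]
    rw [e, norm_smul, norm_inv, Complex.norm_real, Real.norm_of_nonneg he.le, inv_mul_le_iff₀ he]
    have := h3 (φ k)
    linarith
  have hz : A₀ y0 = 0 := by
    have h4 := hε.smul hr
    rw [smul_zero] at h4
    have h5 := h4.sub (hε.smul hA1)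
    rw [zero_smul, sub_zero] at h5
    refine tendsto_nhds_unique hA0 (h5.congr fun k => ?_)
    have hne : (ε (φ k) : ℂ) ≠ 0 := by exact_mod_cast (h0 (φ k)).ne'
    rw [smul_add, map_smul, smul_smul, mul_inv_cancel₀ hne, one_smul, add_sub_cancel_right]
  have hcl : IsClosed ((LinearMap.range A₀.toLinearMap : Submodule ℂ (Fin n → ℂ)) : Set (Fin n → ℂ)) :=
    Submodule.closed_of_finiteDimensional _
  have hmem : -(A₁ y0) ∈ (LinearMap.range A₀.toLinearMap : Set (Fin n → ℂ)) := by
    have h6 := hr.sub hA1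
    rw [zero_sub] at h6
    refine hcl.mem_of_tendsto h6 (Filter.Eventually.of_forall fun k => ?_)
    exact ⟨((ε (φ k) : ℂ))⁻¹ • y (φ k), by simp⟩
  obtain ⟨x, hx⟩ := hmem
  refine h y0 ?_ hz x ?_
  · rintro rfl
    simp at hy0
  · have hx' : A₀ x = -(A₁ y0) := hx
    rw [hx']
    simp

/-- the primitive operator -/
noncomputable def prim {n : ℕ} (T : ℝ) (h : ℝ → Fin n → ℂ) (t : ℝ) : Fin n → ℂ :=
  (∫ s in (0 : ℝ)..t, h s) - (t / T) • ∫ s in (0 : ℝ)..T, h s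

lemma prim_hasDerivAt {n : ℕ} (T : ℝ) {h : ℝ → Fin n → ℂ} (hc : Continuous h) (t : ℝ) :
    HasDerivAt (prim T h) (h t - T⁻¹ • ∫ s in (0 : ℝ)..T, h s) t := by
  have h1 := intervalIntegral.integral_hasDerivAt_right (hc.intervalIntegrable 0 t)
    (hc.stronglyMeasurableAtFilter _ _) hc.continuousAt
  have h2 : HasDerivAt (fun t : ℝ => (t / T) • ∫ s in (0 : ℝ)..T, h s)
      ((1 / T) • ∫ s in (0 : ℝ)..T, h s) t := ((hasDerivAt_id t).div_const T).smul_const _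
  have := h1.sub h2
  rw [one_div] at this
  exact this

lemma prim_periodic {n : ℕ} {T : ℝ} (hT : 0 < T) {h : ℝ → Fin n → ℂ} (hc : Continuous h)
    (hp : Function.Periodic h T) : Function.Periodic (prim T h) T := by
  intro t
  unfold prim
  have h1 := intervalIntegral.integral_add_adjacent_intervals
    (hc.intervalIntegrable (μ := MeasureTheory.volume) 0 t) (hc.intervalIntegrable t (t + T))
  have h2 := hp.intervalIntegral_add_eq t 0
  rw [zero_add] at h2
  rw [← h1, h2, add_div, div_self hT.ne', add_smul, one_smul]
  abel

lemma prim_zero {n : ℕ} (T : ℝ) (h : ℝ → Fin n → ℂ) : prim T h 0 = 0 := by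
  simp [prim]

lemma prim_bound {n : ℕ} {T : ℝ} (hT : 0 < T) {h : ℝ → Fin n → ℂ} (hc : Continuous h)
    (hp : Function.Periodic h T) {C : ℝ} (hC : ∀ t, ‖h t‖ ≤ C) (t : ℝ) :
    ‖prim T h t‖ ≤ 2 * T * C := by
  obtain ⟨s, hs, hst⟩ := (prim_periodic hT hc hp).exists_mem_Ico₀ hT t
  rw [hst]
  have hC0 : 0 ≤ C := (norm_nonneg _).trans (hC 0)
  have h1 : ‖∫ r in (0 : ℝ)..s, h r‖ ≤ C * |s - 0| :=
    intervalIntegral.norm_integral_le_of_norm_le_const fun r _ => hC r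
  have h2 : ‖∫ r in (0 : ℝ)..T, h r‖ ≤ C * |T - 0| :=
    intervalIntegral.norm_integral_le_of_norm_le_const fun r _ => hC r
  rw [sub_zero, abs_of_nonneg hs.1] at h1
  rw [sub_zero, abs_of_pos hT] at h2
  have h3 : ‖(s / T) • ∫ r in (0 : ℝ)..T, h r‖ ≤ C * T := by
    rw [norm_smul, Real.norm_of_nonneg (div_nonneg hs.1 hT.le)]
    have : s / T ≤ 1 := (div_le_one hT).2 hs.2.le
    calc _ ≤ 1 * (C * T) := by gcongr
      _ = _ := one_mul _
  have h4 : C * s ≤ C * T := by gcongr; exact hs.2.le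
  calc _ ≤ _ := norm_sub_le _ _
    _ ≤ _ := by linarith

lemma prim_add {n : ℕ} (T : ℝ) {h k : ℝ → Fin n → ℂ} (hc : Continuous h) (kc : Continuous k) (t : ℝ) :
    prim T (fun s => h s + k s) t = prim T h t + prim T k t := by
  unfold prim
  rw [intervalIntegral.integral_add (hc.intervalIntegrable _ _) (kc.intervalIntegrable _ _),
    intervalIntegral.integral_add (hc.intervalIntegrable _ _) (kc.intervalIntegrable _ _), smul_add]
  abel

lemma prim_smul {n : ℕ} (T : ℝ) {h : ℝ → Fin n → ℂ} (c : ℂ) (t : ℝ) :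
    prim T (fun s => c • h s) t = c • prim T h t := by
  unfold prim
  rw [intervalIntegral.integral_smul, intervalIntegral.integral_smul, smul_sub, smul_comm]

/-- periodic bounded continuous functions -/
def Per (n : ℕ) (T : ℝ) : @Submodule ℂ (BoundedContinuousFunction ℝ (Fin n → ℂ)) _
    (SeminormedAddCommGroup.toAddCommGroup.toAddCommMonoid) (NormedSpace.toModule) where
  carrier := {f | ∀ t, f (t + T) = f t}
  add_mem' := by
    intro f g hf hg t
    simp [hf t, hg t]
  zero_mem' := by intro t; simp
  smul_mem' := by
    intro c f hf t
    simp [hf t]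

lemma Per_closed (n : ℕ) (T : ℝ) :
    IsClosed (Per n T : Set (BoundedContinuousFunction ℝ (Fin n → ℂ))) := by
  have : (Per n T : Set (BoundedContinuousFunction ℝ (Fin n → ℂ))) =
      ⋂ t : ℝ, {f | f (t + T) = f t} := by
    ext f; rw [Set.mem_iInter]; rfl
  rw [this]
  refine isClosed_iInter fun t => isClosed_eq ?_ ?_
  · exact (BoundedContinuousFunction.lipschitz_eval_const _).continuous 
  · exact (BoundedContinuousFunction.lipschitz_eval_const _).continuous 

instance (n : ℕ) (T : ℝ) : CompleteSpace (Per n T) := (Per_closed n T).completeSpace_coe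

lemma periodic_bdd {n : ℕ} {T : ℝ} (hT : 0 < T) {x : ℝ → Fin n → ℂ} (hc : Continuous x)
    (hp : Function.Periodic x T) : ∃ t0 ∈ Set.Icc 0 T, ∀ t, ‖x t‖ ≤ ‖x t0‖ := by
  obtain ⟨t0, h0, h1⟩ := (isCompact_Icc (a := (0 : ℝ)) (b := T)).exists_isMaxOn
    ⟨0, by simp [hT.le]⟩ (hc.norm.continuousOn)
  refine ⟨t0, h0, fun t => ?_⟩
  obtain ⟨s, hs, hst⟩ := hp.exists_mem_Ico₀ hT t
  rw [hst]
  exact h1 ⟨hs.1, hs.2.le⟩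

/-- build an element of `Per` -/
noncomputable def Per.mk' {n : ℕ} {T : ℝ} (hT : 0 < T) (x : ℝ → Fin n → ℂ) (hc : Continuous x)
    (hp : Function.Periodic x T) : Per n T :=
  ⟨BoundedContinuousFunction.ofNormedAddCommGroup x hc ‖x (periodic_bdd hT hc hp).choose‖
    (periodic_bdd hT hc hp).choose_spec.2, hp⟩

@[simp] lemma Per.mk'_apply {n : ℕ} {T : ℝ} (hT : 0 < T) (x : ℝ → Fin n → ℂ) (hc : Continuous x)
    (hp : Function.Periodic x T) (t : ℝ) : (Per.mk' hT x hc hp).1 t = x t := rfl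

lemma Per.ext' {n : ℕ} {T : ℝ} {x y : Per n T} (h : ∀ t, x.1 t = y.1 t) : x = y :=
  Subtype.ext (BoundedContinuousFunction.ext h)

lemma prim_continuous {n : ℕ} (T : ℝ) {h : ℝ → Fin n → ℂ} (hc : Continuous h) :
    Continuous (prim T h) :=
  continuous_iff_continuousAt.2 fun t => (prim_hasDerivAt T hc t).continuousAt

lemma neumann {X : Type*} [NormedAddCommGroup X] [NormedSpace ℂ X] [CompleteSpace X]
    (W0 : X →ₗ[ℂ] X) (q : ℝ) (hW0 : ∀ x, ‖W0 x‖ ≤ q * ‖x‖) (hq0 : 0 ≤ q) (hq : q < 1) :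
    ∃ S : X →ₗ[ℂ] X, ∀ y, S y = y + W0 (S y) := by
  let W : X →L[ℂ] X := W0.mkContinuous q hW0
  have hWn : ‖W‖ < 1 := (W0.mkContinuous_norm_le hq0 hW0).trans_lt hq
  obtain ⟨R, hR⟩ := isUnit_one_sub_of_norm_lt_one hWn
  refine ⟨((R⁻¹ : (X →L[ℂ] X)ˣ) : X →L[ℂ] X).toLinearMap, fun y => ?_⟩
  have h1 : (R : X →L[ℂ] X) * ((R⁻¹ : (X →L[ℂ] X)ˣ)) = 1 := R.mul_inv
  rw [hR] at h1
  have := congrArg (fun L => L y) h1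
  simp only [mul_apply_eq_comp, _root_.sub_apply,
    one_apply_eq_self] at this
  exact sub_eq_iff_eq_add.1 this

/-- Fredholm alternative for periodic linear equations with short period. -/
lemma fred {n : ℕ} {T : ℝ} (hT : 0 < T) (F : ℝ → (Fin n → ℂ) →L[ℂ] (Fin n → ℂ))
    (hF : Continuous F) (hFp : Function.Periodic F T) (K : ℝ) (hK : ∀ t, ‖F t‖ ≤ K)
    (hTK : 2 * T * K < 1)
    (hhom : ∀ x : ℝ → Fin n → ℂ, (∀ t, HasDerivAt x (F t (x t)) t) → Function.Periodic x T → x = 0)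
    (g : ℝ → Fin n → ℂ) (hg : Continuous g) (hgp : Function.Periodic g T) :
    ∃! x : ℝ → Fin n → ℂ, (∀ t, HasDerivAt x (F t (x t) + g t) t) ∧ Function.Periodic x T := by
  have hK0 : 0 ≤ K := (norm_nonneg _).trans (hK 0)
  have hFc : ∀ x : Per n T, Continuous fun t => F t (x.1 t) := fun x =>
    hF.clm_apply x.1.continuous
  have hFpp : ∀ x : Per n T, Function.Periodic (fun t => F t (x.1 t)) T := fun x t => by
    simp only [hFp t, x.2 t]
  let W0 : Per n T →ₗ[ℂ] Per n T :=
    { toFun := fun x => Per.mk' hT (prim T fun t => F t (x.1 t)) (prim_continuous T (hFc x))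
        (prim_periodic hT (hFc x) (hFpp x))
      map_add' := fun x y => Per.ext' fun t => by
        have := prim_add T (hFc x) (hFc y) t
        simpa using this
      map_smul' := fun c x => Per.ext' fun t => by
        have := prim_smul T (h := fun t => F t (x.1 t)) c t
        simpa using this }
  have hW0 : ∀ x, ‖W0 x‖ ≤ (2 * T * K) * ‖x‖ := by
    intro x
    refine (BoundedContinuousFunction.norm_le (by positivity)).2 fun t => ?_
    have := prim_bound hT (hFc x) (hFpp x) (C := K * ‖x‖) (fun t =>
      (F t).le_of_opNorm_le_of_le (hK t) (x.1.norm_coe_le_norm t)) t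
    calc _ ≤ _ := this
      _ = _ := by ring
  obtain ⟨S, hRR⟩ := neumann W0 (2 * T * K) hW0 (by positivity) hTK
  have hW : ∀ x t, (W0 x).1 t = prim T (fun t => F t (x.1 t)) t := fun x t => rfl
  let κ : (Fin n → ℂ) →ₗ[ℂ] Per n T :=
    { toFun := fun p => Per.mk' hT (fun _ => p) continuous_const (fun _ => rfl)
      map_add' := fun p q => Per.ext' fun t => rfl
      map_smul' := fun c q => Per.ext' fun t => rfl }
  have hκ : ∀ p t, (κ p).1 t = p := fun p t => rfl
  let J : Per n T →ₗ[ℂ] (Fin n → ℂ) :=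
    { toFun := fun x => ∫ t in (0 : ℝ)..T, F t (x.1 t)
      map_add' := fun x y => by
        rw [← intervalIntegral.integral_add ((hFc x).intervalIntegrable _ _)
          ((hFc y).intervalIntegrable _ _)]
        simp
      map_smul' := fun c x => by
        simp only [RingHom.id_apply]
        rw [← intervalIntegral.integral_smul]
        simp }
  have hJ : ∀ x, J x = ∫ t in (0 : ℝ)..T, F t (x.1 t) := fun x => rfl
  let P : (Fin n → ℂ) →ₗ[ℂ] (Fin n → ℂ) := J ∘ₗ S ∘ₗ κ
  have hP : ∀ p, P p = J (S (κ p)) := fun p => rfl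
  have hinj : Function.Injective P := by
    rw [← LinearMap.ker_eq_bot, LinearMap.ker_eq_bot']
    intro p hp
    have hx := hRR (κ p)
    rw [hP] at hp
    generalize S (κ p) = x at hx hp
    have hxf : (fun t => x.1 t) = fun t => p + prim T (fun t => F t (x.1 t)) t := by
      funext t
      conv_lhs => rw [hx]
      rfl
    have hx0 : (fun t => x.1 t) = 0 := by
      refine hhom _ (fun t => ?_) x.2
      have h1 := (prim_hasDerivAt T (hFc x) t).const_add p
      rw [← hJ, hp, smul_zero, sub_zero] at h1
      have h2 : HasDerivAt (fun t => x.1 t) (F t (x.1 t)) t := by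
        rw [hxf]; exact h1
      exact h2
    have := congrFun hxf 0
    have h0 : x.1 0 = 0 := congrFun hx0 0
    rw [prim_zero, h0, add_zero] at this
    exact this.symm
  have hsurj : Function.Surjective P := LinearMap.injective_iff_surjective.1 hinj
  let G : Per n T := Per.mk' hT (prim T g) (prim_continuous T hg) (prim_periodic hT hg hgp)
  obtain ⟨p, hp⟩ := hsurj (-(∫ t in (0 : ℝ)..T, g t) - J (S G))
  have hx' : ∀ t, HasDerivAt (fun t => (S (κ p + G)).1 t) (F t ((S (κ p + G)).1 t) + g t) t := by
    intro t
    have hx := hRR (κ p + G)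
    have hJx : J (S (κ p + G)) = -(∫ t in (0 : ℝ)..T, g t) := by
      rw [map_add, map_add, ← hP, hp]
      abel
    generalize S (κ p + G) = x at hx hJx
    have hxf : (fun t => x.1 t) = fun t => p + prim T g t + prim T (fun t => F t (x.1 t)) t := by
      funext t
      conv_lhs => rw [hx]
      rfl
    have h1 := ((prim_hasDerivAt T hg t).const_add p).add (prim_hasDerivAt T (hFc x) t)
    rw [← hJ, hJx] at h1
    have e : F t (x.1 t) + g t = (g t - T⁻¹ • ∫ s in (0 : ℝ)..T, g s) +
        (F t (x.1 t) - T⁻¹ • -∫ t in (0 : ℝ)..T, g t) := by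
      rw [smul_neg]
      abel
    rw [e]
    have h2 : HasDerivAt (fun t => x.1 t) ((g t - T⁻¹ • ∫ s in (0 : ℝ)..T, g s) +
        (F t (x.1 t) - T⁻¹ • -∫ t in (0 : ℝ)..T, g t)) t := by
      rw [hxf]; exact h1
    exact h2
  refine ⟨fun t => (S (κ p + G)).1 t, ⟨hx', (S (κ p + G)).2⟩, ?_⟩
  · rintro y ⟨hy, hyp⟩
    have := hhom (fun t => y t - (S (κ p + G)).1 t) (fun t => by
      have := (hy t).sub (hx' t)
      have e : F t (y t) + g t - (F t ((S (κ p + G)).1 t) + g t) =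
          F t (y t - (S (κ p + G)).1 t) := by
        rw [map_sub]; abel
      rw [e] at this
      exact this) (fun t => by
      have : (S (κ p + G)).1 (t + T) = _ := (S (κ p + G)).2 t
      simp only [hyp t, this])
    funext t
    exact sub_eq_zero.1 (congrFun this t)

noncomputable def osc (ω : ℝ) (l : ℤ) (t : ℝ) : ℂ := Complex.exp (Complex.I * (l : ℂ) * (ω : ℂ) * (t : ℂ))

lemma osc_norm (ω : ℝ) (l : ℤ) (t : ℝ) : ‖osc ω l t‖ = 1 := by
  unfold osc
  have : Complex.I * (l : ℂ) * (ω : ℂ) * (t : ℂ) = ((l * ω * t : ℝ) : ℂ) * Complex.I := by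
    push_cast; ring
  rw [this, Complex.norm_exp_ofReal_mul_I]

lemma osc_hasDerivAt (ω : ℝ) (l : ℤ) (t : ℝ) :
    HasDerivAt (osc ω l) (Complex.I * l * ω * osc ω l t) t := by
  unfold osc
  have h1 : HasDerivAt (fun t : ℝ => Complex.I * (l : ℂ) * (ω : ℂ) * (t : ℂ))
      (Complex.I * (l : ℂ) * (ω : ℂ) * 1) t := (Complex.ofRealCLM.hasDerivAt).const_mul _
  have := h1.cexp
  convert this using 1
  ring

lemma osc_continuous (ω : ℝ) (l : ℤ) : Continuous (osc ω l) :=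
  continuous_iff_continuousAt.2 fun t => (osc_hasDerivAt ω l t).continuousAt

lemma osc_add (ω : ℝ) (l k : ℤ) (t : ℝ) : osc ω l t * osc ω k t = osc ω (l + k) t := by
  unfold osc
  rw [← Complex.exp_add]
  congr 1
  push_cast
  ring

lemma osc_periodic {ω : ℝ} (hω : 0 < ω) (l : ℤ) : Function.Periodic (osc ω l) (2 * Real.pi / ω) := by
  intro t
  unfold osc
  have hne : (ω : ℂ) ≠ 0 := by exact_mod_cast hω.ne'
  have : Complex.I * (l : ℂ) * (ω : ℂ) * ((t + 2 * Real.pi / ω : ℝ) : ℂ) =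
      Complex.I * (l : ℂ) * (ω : ℂ) * (t : ℂ) + l * (2 * Real.pi * Complex.I) := by
    push_cast
    field_simp
  rw [this, Complex.exp_add, Complex.exp_int_mul_two_pi_mul_I, mul_one]

lemma osc_integral {ω : ℝ} (hω : 0 < ω) {l : ℤ} (hl : l ≠ 0) :
    ∫ t in (0 : ℝ)..(2 * Real.pi / ω), osc ω l t = 0 := by
  have hne : (ω : ℂ) ≠ 0 := by exact_mod_cast hω.ne'
  have hlc : (l : ℂ) ≠ 0 := by exact_mod_cast hl
  have h := intervalIntegral.integral_eq_sub_of_hasDerivAt (a := 0) (b := 2 * Real.pi / ω)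
    (f := osc ω l) (f' := fun t => Complex.I * l * ω * osc ω l t)
    (fun t _ => osc_hasDerivAt ω l t)
    ((continuous_const.mul (osc_continuous ω l)).intervalIntegrable _ _)
  have hp := osc_periodic hω l 0
  rw [zero_add] at hp
  rw [hp, sub_self, intervalIntegral.integral_const_mul] at h
  have hc : Complex.I * l * ω ≠ 0 := mul_ne_zero (mul_ne_zero Complex.I_ne_zero hlc) hne
  exact (mul_eq_zero.1 h).resolve_left hc

lemma osc_zero (ω t : ℝ) : osc ω 0 t = 1 := by simp [osc]

section
variable {n : ℕ}

/-- oscillating part -/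
noncomputable def Bf (B : ℤ → (Fin n → ℂ) →L[ℂ] (Fin n → ℂ)) (S : Finset ℤ) (ω t : ℝ) :
    (Fin n → ℂ) →L[ℂ] (Fin n → ℂ) := ∑ l ∈ S, osc ω l t • B l

/-- its antiderivative -/
noncomputable def Uf (B : ℤ → (Fin n → ℂ) →L[ℂ] (Fin n → ℂ)) (S : Finset ℤ) (ω t : ℝ) :
    (Fin n → ℂ) →L[ℂ] (Fin n → ℂ) := ∑ l ∈ S, ((Complex.I * l * ω)⁻¹ * osc ω l t) • B l

variable (B : ℤ → (Fin n → ℂ) →L[ℂ] (Fin n → ℂ)) (S : Finset ℤ)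

lemma Bf_apply (ω t : ℝ) (y : Fin n → ℂ) : Bf B S ω t y = ∑ l ∈ S, osc ω l t • B l y := by
  simp [Bf]

lemma Uf_apply (ω t : ℝ) (y : Fin n → ℂ) :
    Uf B S ω t y = ∑ l ∈ S, ((Complex.I * l * ω)⁻¹ * osc ω l t) • B l y := by
  simp [Uf]

lemma Bf_continuous (ω : ℝ) : Continuous (Bf B S ω) :=
  continuous_finsetSum _ fun l _ => (osc_continuous ω l).smul continuous_const

lemma Uf_continuous (ω : ℝ) : Continuous (Uf B S ω) :=
  continuous_finsetSum _ fun l _ => (continuous_const.mul (osc_continuous ω l)).smul continuous_const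

lemma Bf_norm (ω t : ℝ) : ‖Bf B S ω t‖ ≤ ∑ l ∈ S, ‖B l‖ := by
  refine norm_sum_le_of_le _ fun l _ => ?_
  rw [norm_smul, osc_norm, one_mul]

lemma Uf_norm {ω : ℝ} (hω : 0 < ω) (hS : 0 ∉ S) (t : ℝ) : ‖Uf B S ω t‖ ≤ ω⁻¹ * ∑ l ∈ S, ‖B l‖ := by
  rw [Finset.mul_sum]
  refine norm_sum_le_of_le _ fun l hl => ?_
  rw [norm_smul, norm_mul, osc_norm, mul_one]
  gcongr
  have hl0 : l ≠ 0 := fun h => hS (h ▸ hl)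
  have h1 : (1 : ℝ) ≤ |(l : ℝ)| := by exact_mod_cast Int.one_le_abs hl0
  rw [norm_inv, norm_mul, norm_mul, Complex.norm_I, one_mul, Complex.norm_intCast,
    Complex.norm_real, Real.norm_of_nonneg hω.le]
  apply inv_anti₀ hω
  nlinarith

lemma Bf_periodic {ω : ℝ} (hω : 0 < ω) : Function.Periodic (Bf B S ω) (2 * Real.pi / ω) := by
  intro t
  unfold Bf
  exact Finset.sum_congr rfl fun l _ => by rw [osc_periodic hω l t]

lemma Uf_periodic {ω : ℝ} (hω : 0 < ω) : Function.Periodic (Uf B S ω) (2 * Real.pi / ω) := by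
  intro t
  unfold Uf
  exact Finset.sum_congr rfl fun l _ => by rw [osc_periodic hω l t]

lemma clm_hasDerivAt (L : (Fin n → ℂ) →L[ℂ] (Fin n → ℂ)) {x : ℝ → Fin n → ℂ} {x' : Fin n → ℂ} {t : ℝ}
    (hx : HasDerivAt x x' t) : HasDerivAt (fun t => L (x t)) (L x') t :=
  (L.restrictScalars ℝ).hasFDerivAt.comp_hasDerivAt t hx

lemma Uf_hasDerivAt {ω : ℝ} (hω : 0 < ω) (hS : 0 ∉ S) {x : ℝ → Fin n → ℂ} {x' : Fin n → ℂ} {t : ℝ}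
    (hx : HasDerivAt x x' t) :
    HasDerivAt (fun t => Uf B S ω t (x t)) (Uf B S ω t x' + Bf B S ω t (x t)) t := by
  simp only [Uf_apply, Bf_apply]
  rw [← Finset.sum_add_distrib]
  refine HasDerivAt.fun_sum fun l hl => ?_
  have hne : (ω : ℂ) ≠ 0 := by exact_mod_cast hω.ne'
  have hlc : (l : ℂ) ≠ 0 := by
    have hl0 : l ≠ 0 := fun h => hS (h ▸ hl)
    exact_mod_cast hl0
  have hc : Complex.I * l * ω ≠ 0 := mul_ne_zero (mul_ne_zero Complex.I_ne_zero hlc) hne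
  have h1 := ((osc_hasDerivAt ω l t).const_mul (Complex.I * l * ω)⁻¹).smul (clm_hasDerivAt (B l) hx)
  rw [← mul_assoc, inv_mul_cancel₀ hc, one_mul] at h1
  exact h1

lemma Uf_integral {ω : ℝ} (hω : 0 < ω) (hS : 0 ∉ S) (v : Fin n → ℂ) :
    ∫ t in (0 : ℝ)..(2 * Real.pi / ω), Uf B S ω t v = 0 := by
  simp only [Uf_apply]
  rw [intervalIntegral.integral_finsetSum]
  · refine Finset.sum_eq_zero fun l hl => ?_
    have hl0 : l ≠ 0 := fun h => hS (h ▸ hl)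
    rw [intervalIntegral.integral_smul_const, intervalIntegral.integral_const_mul,
      osc_integral hω hl0, mul_zero, zero_smul]
  · intro l _
    exact (((continuous_const.mul (osc_continuous ω l)).smul continuous_const)).intervalIntegrable _ _

lemma UB_integral {ω : ℝ} (hω : 0 < ω) (hsym : ∀ l ∈ S, -l ∈ S) (v : Fin n → ℂ) :
    ∫ t in (0 : ℝ)..(2 * Real.pi / ω), Uf B S ω t (Bf B S ω t v) =
      -((2 * Real.pi / ω : ℝ) : ℂ) • (ω : ℂ)⁻¹ • ∑ l ∈ S, (Complex.I * l)⁻¹ • B (-l) (B l v) := by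
  have e : ∀ t, Uf B S ω t (Bf B S ω t v) = ∑ l ∈ S, ∑ k ∈ S,
      ((Complex.I * l * ω)⁻¹ * osc ω (l + k) t) • B l (B k v) := by
    intro t
    rw [Uf_apply]
    refine Finset.sum_congr rfl fun l _ => ?_
    rw [Bf_apply, map_sum, Finset.smul_sum]
    refine Finset.sum_congr rfl fun k _ => ?_
    rw [map_smul, smul_smul, mul_assoc, osc_add]
  have h_intble : ∀ l k : ℤ, IntervalIntegrable (fun t => ((Complex.I * l * ω)⁻¹ * osc ω (l + k) t) • B l (B k v))
      MeasureTheory.volume 0 (2 * Real.pi / ω) := fun l k =>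
    (((continuous_const.mul (osc_continuous ω (l + k))).smul continuous_const)).intervalIntegrable _ _
  simp only [e]
  rw [intervalIntegral.integral_finsetSum]
  swap
  · intro l _
    exact (continuous_finsetSum _ fun k _ =>
      ((continuous_const.mul (osc_continuous ω (l + k))).smul continuous_const)).intervalIntegrable _ _
  have h1 : ∀ l ∈ S, ∫ t in (0 : ℝ)..(2 * Real.pi / ω), ∑ k ∈ S,
      ((Complex.I * l * ω)⁻¹ * osc ω (l + k) t) • B l (B k v) =
      ((Complex.I * l * ω)⁻¹ * ((2 * Real.pi / ω : ℝ) : ℂ)) • B l (B (-l) v) := by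
    intro l hl
    rw [intervalIntegral.integral_finsetSum fun k _ => h_intble l k]
    rw [Finset.sum_eq_single (-l)]
    · rw [intervalIntegral.integral_smul_const, intervalIntegral.integral_const_mul]
      simp [osc_zero]
    · intro k _ hk
      have : l + k ≠ 0 := fun h => hk (by omega)
      rw [intervalIntegral.integral_smul_const, intervalIntegral.integral_const_mul,
        osc_integral hω this, mul_zero, zero_smul]
    · intro h
      exact absurd (hsym l hl) h
  rw [Finset.sum_congr rfl h1, Finset.smul_sum, Finset.smul_sum]
  refine Finset.sum_nbij' (fun l => -l) (fun l => -l) hsym hsym (by simp) (by simp) fun l _ => ?_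
  rw [neg_neg, smul_smul, smul_smul]
  congr 1
  push_cast
  rw [mul_inv, mul_neg, inv_neg]
  ring

lemma hom_estimate (A₀ B₀ : (Fin n → ℂ) →L[ℂ] (Fin n → ℂ)) (hS : 0 ∉ S) (hsym : ∀ l ∈ S, -l ∈ S)
    (D : (Fin n → ℂ) →L[ℂ] (Fin n → ℂ))
    (hD : ∀ v, D v = ∑ l ∈ S, (Complex.I * l)⁻¹ • B (-l) (B l v))
    {ω : ℝ} (hω : 0 < ω) (K M r N : ℝ) (hM : M = ∑ l ∈ S, ‖B l‖)
    (hK : K = ‖A₀‖ + ‖B₀‖ + M) (hω1 : 1 ≤ ω) (x : ℝ → Fin n → ℂ)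
    (hx : ∀ t, HasDerivAt x ((A₀ + (ω : ℂ)⁻¹ • B₀ + Bf B S ω t) (x t)) t)
    (hp : Function.Periodic x (2 * Real.pi / ω)) (hN : ∀ t, ‖x t‖ ≤ N)
    (hr : r = K * N * (2 * Real.pi / ω)) :
    ∃ y : Fin n → ℂ, (∀ t ∈ Set.Icc 0 (2 * Real.pi / ω), ‖x t‖ ≤ ‖y‖ + 2 * r) ∧
      ‖A₀ y + (ω : ℂ)⁻¹ • (B₀ + D) y‖ ≤
        ω⁻¹ * (M * ‖A₀‖ * r + ω⁻¹ * M * ‖B₀‖ * N + M * M * r + ‖D‖ * r) := by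
  set T := 2 * Real.pi / ω with hT
  have hTpos : 0 < T := by have := Real.pi_pos; positivity
  have hTne : (T : ℂ) ≠ 0 := by exact_mod_cast hTpos.ne'
  have hM0 : 0 ≤ M := by rw [hM]; positivity
  have hN0 : 0 ≤ N := (norm_nonneg _).trans (hN 0)
  have hωn : ‖(ω : ℂ)⁻¹‖ = ω⁻¹ := by
    rw [norm_inv, Complex.norm_real, Real.norm_of_nonneg hω.le]
  have hωi : ω⁻¹ ≤ 1 := inv_le_one_of_one_le₀ hω1
  have hωi0 : 0 ≤ ω⁻¹ := by positivity
  have hxc : Continuous x := continuous_iff_continuousAt.2 fun t => (hx t).continuousAt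
  have hUn : ∀ t, ‖Uf B S ω t‖ ≤ ω⁻¹ * M := fun t => hM ▸ Uf_norm B S hω hS t
  have hBn : ∀ t, ‖Bf B S ω t‖ ≤ M := fun t => hM ▸ Bf_norm B S ω t
  have hFn : ∀ t, ‖A₀ + (ω : ℂ)⁻¹ • B₀ + Bf B S ω t‖ ≤ K := by
    intro t
    have h1 : ‖(ω : ℂ)⁻¹ • B₀‖ ≤ ‖B₀‖ := by
      rw [norm_smul, hωn]
      exact mul_le_of_le_one_left (norm_nonneg _) hωi
    have := norm_add₃_le (a := A₀) (b := (ω : ℂ)⁻¹ • B₀) (c := Bf B S ω t)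
    have := hBn t
    linarith
  have hK0 : 0 ≤ K := (norm_nonneg _).trans (hFn 0)
  have hr0 : 0 ≤ r := by rw [hr]; positivity
  have hxv : ∀ t ∈ Set.Icc 0 T, ‖x t - x 0‖ ≤ r := by
    intro t ht
    have h1 := Convex.norm_image_sub_le_of_norm_hasDerivWithin_le (s := Set.univ) (f := x)
      (C := K * N) (x := 0) (y := t) (fun t _ => (hx t).hasDerivWithinAt)
      (fun t _ => ContinuousLinearMap.le_of_opNorm_le_of_le _ (hFn t) (hN t)) convex_univ trivial trivial
    rw [sub_zero, Real.norm_of_nonneg ht.1] at h1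
    rw [hr]
    exact h1.trans (by gcongr; exact ht.2)
  set v := x 0 with hv
  have hii : ∀ {f : ℝ → Fin n → ℂ}, Continuous f → IntervalIntegrable f MeasureTheory.volume 0 T :=
    fun hf => hf.intervalIntegrable _ _
  set y : Fin n → ℂ := (T : ℂ)⁻¹ • ∫ t in (0 : ℝ)..T, x t with hy
  have hyT : ∫ t in (0 : ℝ)..T, x t = (T : ℂ) • y := by
    rw [hy, smul_smul, mul_inv_cancel₀ hTne, one_smul]
  have hTn : ‖(T : ℂ)‖ = T := by rw [Complex.norm_real, Real.norm_of_nonneg hTpos.le]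
  have hbd : ∀ {f : ℝ → Fin n → ℂ} {C : ℝ}, (∀ t ∈ Set.Icc 0 T, ‖f t‖ ≤ C) →
      ‖∫ t in (0 : ℝ)..T, f t‖ ≤ C * T := by
    intro f C hf
    have := intervalIntegral.norm_integral_le_of_norm_le_const (a := 0) (b := T) (f := f) (C := C)
      (fun t ht => hf t (by rw [Set.uIoc_of_le hTpos.le] at ht; exact ⟨ht.1.le, ht.2⟩))
    rwa [sub_zero, abs_of_pos hTpos] at this
  have hyv : ‖y - v‖ ≤ r := by
    have h1 : (T : ℂ) • (y - v) = ∫ t in (0 : ℝ)..T, (x t - v) := by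
      rw [intervalIntegral.integral_sub (hii hxc) (hii continuous_const), hyT, smul_sub,
        intervalIntegral.integral_const, sub_zero, Complex.coe_smul T v]
    have h2 : ‖(T : ℂ) • (y - v)‖ ≤ r * T := h1 ▸ hbd hxv
    rw [norm_smul, hTn, mul_comm] at h2
    exact le_of_mul_le_mul_right h2 hTpos
  refine ⟨y, fun t ht => ?_, ?_⟩
  · have h1 := hxv t ht
    have h2 : ‖x t‖ ≤ ‖x t - v‖ + ‖v - y‖ + ‖y‖ := by
      have := norm_add₃_le (a := x t - v) (b := v - y) (c := y)
      simpa using this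
    rw [norm_sub_rev v y] at h2
    linarith
  have hUc := Uf_continuous B S ω
  have hBc := Bf_continuous B S ω
  -- the remainder
  let R : ℝ → Fin n → ℂ := fun t => Uf B S ω t (A₀ (x t - v)) + (ω : ℂ)⁻¹ • Uf B S ω t (B₀ (x t)) +
    Uf B S ω t (Bf B S ω t (x t - v))
  have hRc : Continuous R := by
    refine ((hUc.clm_apply (A₀.continuous.comp (hxc.sub continuous_const))).add
      ((hUc.clm_apply (B₀.continuous.comp hxc)).const_smul ((ω : ℂ)⁻¹))).add
      (hUc.clm_apply (hBc.clm_apply (hxc.sub continuous_const)))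
  have hRb : ∀ t ∈ Set.Icc 0 T, ‖R t‖ ≤
      ω⁻¹ * M * (‖A₀‖ * r) + ω⁻¹ * (ω⁻¹ * M * (‖B₀‖ * N)) + ω⁻¹ * M * (M * r) := by
    intro t ht
    refine norm_add₃_le.trans (add_le_add (add_le_add ?_ ?_) ?_)
    · exact ContinuousLinearMap.le_of_opNorm_le_of_le _ (hUn t)
        (ContinuousLinearMap.le_of_opNorm_le_of_le _ le_rfl (hxv t ht))
    · rw [norm_smul, hωn]
      gcongr
      exact ContinuousLinearMap.le_of_opNorm_le_of_le _ (hUn t)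
        (ContinuousLinearMap.le_of_opNorm_le_of_le _ le_rfl (hN t))
    · exact ContinuousLinearMap.le_of_opNorm_le_of_le _ (hUn t)
        (ContinuousLinearMap.le_of_opNorm_le_of_le _ (hBn t) (hxv t ht))
  have hRi := hbd hRb
  -- derivative of z
  have hz : ∀ t, HasDerivAt (fun t => x t - Uf B S ω t (x t))
      ((A₀ + (ω : ℂ)⁻¹ • B₀) (x t) - R t - Uf B S ω t (A₀ v) - Uf B S ω t (Bf B S ω t v)) t := by
    intro t
    have h1 := (hx t).sub (Uf_hasDerivAt B S hω hS (hx t))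
    have e : (A₀ + (ω : ℂ)⁻¹ • B₀ + Bf B S ω t) (x t) -
        (Uf B S ω t ((A₀ + (ω : ℂ)⁻¹ • B₀ + Bf B S ω t) (x t)) + Bf B S ω t (x t)) =
        (A₀ + (ω : ℂ)⁻¹ • B₀) (x t) - R t - Uf B S ω t (A₀ v) - Uf B S ω t (Bf B S ω t v) := by
      simp only [R, _root_.add_apply, _root_.smul_apply, map_add, map_sub, map_smul]
      abel
    rw [e] at h1
    exact h1
  have hL : Continuous fun t => (A₀ + (ω : ℂ)⁻¹ • B₀) (x t) :=
    (A₀ + (ω : ℂ)⁻¹ • B₀).continuous.comp hxc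
  have hU1 : Continuous fun t => Uf B S ω t (A₀ v) := hUc.clm_apply continuous_const
  have hU2 : Continuous fun t => Uf B S ω t (Bf B S ω t v) :=
    hUc.clm_apply (hBc.clm_apply continuous_const)
  have hL2 : Continuous fun t => (A₀ + (ω : ℂ)⁻¹ • B₀) (x t) - R t := hL.sub hRc
  have hL3 : Continuous fun t => (A₀ + (ω : ℂ)⁻¹ • B₀) (x t) - R t - Uf B S ω t (A₀ v) := hL2.sub hU1
  have hI := intervalIntegral.integral_eq_sub_of_hasDerivAt (a := 0) (b := T) (fun t _ => hz t)
    (hii (hL3.sub hU2))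
  have hxT : x T = x 0 := by simpa using hp 0
  have hUT : Uf B S ω T = Uf B S ω 0 := by simpa using Uf_periodic B S hω 0
  rw [hxT, hUT, sub_self, intervalIntegral.integral_sub (hii hL3) (hii hU2),
    intervalIntegral.integral_sub (hii hL2) (hii hU1),
    intervalIntegral.integral_sub (hii hL) (hii hRc), Uf_integral B S hω hS,
    UB_integral B S hω hsym, ← hD,
    ContinuousLinearMap.intervalIntegral_comp_comm _ (hii hxc), hyT] at hI
  have hkey : (T : ℂ) • (A₀ y + (ω : ℂ)⁻¹ • (B₀ + D) y) =
      (∫ t in (0 : ℝ)..T, R t) + (T : ℂ) • (ω : ℂ)⁻¹ • D (y - v) := by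
    have h2 : ∫ t in (0 : ℝ)..T, R t = (A₀ + (ω : ℂ)⁻¹ • B₀) ((T : ℂ) • y) +
        (T : ℂ) • (ω : ℂ)⁻¹ • D v := by
      rw [neg_smul] at hI
      rw [sub_zero, sub_neg_eq_add, sub_add_eq_add_sub, sub_eq_zero] at hI
      exact hI.symm
    rw [h2]
    simp only [_root_.add_apply, _root_.smul_apply, map_sub, map_smul, smul_add, smul_sub]
    abel
  have hn : ‖(T : ℂ) • (A₀ y + (ω : ℂ)⁻¹ • (B₀ + D) y)‖ ≤
      (ω⁻¹ * M * (‖A₀‖ * r) + ω⁻¹ * (ω⁻¹ * M * (‖B₀‖ * N)) + ω⁻¹ * M * (M * r)) * T +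
      T * (ω⁻¹ * (‖D‖ * r)) := by
    rw [hkey]
    refine (norm_add_le _ _).trans (add_le_add hRi ?_)
    rw [norm_smul, norm_smul, hωn, hTn]
    gcongr
    exact ContinuousLinearMap.le_of_opNorm_le_of_le _ le_rfl hyv
  rw [norm_smul, hTn] at hn
  refine le_of_mul_le_mul_left (hn.trans (le_of_eq ?_)) hTpos
  ring

lemma hom_zero (A₀ B₀ : (Fin n → ℂ) →L[ℂ] (Fin n → ℂ)) (hS : 0 ∉ S) (hsym : ∀ l ∈ S, -l ∈ S)
    (D : (Fin n → ℂ) →L[ℂ] (Fin n → ℂ))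
    (hD : ∀ v, D v = ∑ l ∈ S, (Complex.I * l)⁻¹ • B (-l) (B l v))
    (h : ∀ y, y ≠ 0 → A₀ y = 0 → ∀ x, A₀ x + (B₀ + D) y ≠ 0) :
    ∃ ω₀ : ℝ, 1 ≤ ω₀ ∧ ∀ ω : ℝ, ω₀ < ω → ∀ x : ℝ → Fin n → ℂ,
    (∀ t, HasDerivAt x ((A₀ + (ω : ℂ)⁻¹ • B₀ + Bf B S ω t) (x t)) t) →
    Function.Periodic x (2 * Real.pi / ω) → x = 0 := by
  obtain ⟨c, hc, ε₀, hε₀, hb⟩ := alg_bound A₀ (B₀ + D) h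
  obtain ⟨M, hM⟩ : ∃ M, M = ∑ l ∈ S, ‖B l‖ := ⟨_, rfl⟩
  obtain ⟨K, hK⟩ : ∃ K, K = ‖A₀‖ + ‖B₀‖ + M := ⟨_, rfl⟩
  have hM0 : 0 ≤ M := by rw [hM]; positivity
  have hK0 : 0 ≤ K := by rw [hK]; positivity
  have hpi := Real.pi_pos
  obtain ⟨k, hk⟩ : ∃ k, k = 2 * Real.pi * K := ⟨_, rfl⟩
  have hk0 : 0 ≤ k := by rw [hk]; positivity
  obtain ⟨C, hC⟩ : ∃ C, C = M * ‖A₀‖ * k + M * ‖B₀‖ + M * M * k + ‖D‖ * k := ⟨_, rfl⟩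
  have hC0 : 0 ≤ C := by rw [hC]; positivity
  refine ⟨1 + ε₀⁻¹ + 4 * k + 2 * C / c, ?_, ?_⟩
  · have : 0 ≤ ε₀⁻¹ + 4 * k + 2 * C / c := by positivity
    linarith
  intro ω hω x hx hp
  have h1 : 0 < ε₀⁻¹ := by positivity
  have h2 : 0 ≤ 2 * C / c := by positivity
  have hω1 : 1 ≤ ω := by linarith
  have hω0 : 0 < ω := by linarith
  have hT : 0 < 2 * Real.pi / ω := by positivity
  have hxc : Continuous x := continuous_iff_continuousAt.2 fun t => (hx t).continuousAt
  obtain ⟨t0, ht0, hN⟩ := periodic_bdd hT hxc hp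
  obtain ⟨N, hNe⟩ : ∃ N, N = ‖x t0‖ := ⟨_, rfl⟩
  rw [← hNe] at hN
  have hN0 : 0 ≤ N := by rw [hNe]; positivity
  obtain ⟨r, hr⟩ : ∃ r, r = K * N * (2 * Real.pi / ω) := ⟨_, rfl⟩
  obtain ⟨y, hy1, hy2⟩ := hom_estimate B S A₀ B₀ hS hsym D hD hω0 K M r N hM hK hω1 x hx hp hN hr
  have hr' : r = ω⁻¹ * (k * N) := by
    rw [hr, hk]; ring
  have hlow := hb ω⁻¹ (by positivity) (by
    rw [inv_lt_comm₀ hω0 hε₀]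
    have : 0 ≤ 4 * k := by positivity
    linarith) y
  push_cast at hlow
  have hNy : N ≤ ‖y‖ + 2 * r := hNe ▸ hy1 t0 ht0
  have hNy2 : N ≤ 2 * ‖y‖ := by
    have h4 : 4 * r ≤ N := by
      rw [hr']
      have : 4 * k * N ≤ ω * N := by
        gcongr
        linarith
      rw [show 4 * (ω⁻¹ * (k * N)) = ω⁻¹ * (4 * k * N) by ring, inv_mul_le_iff₀ hω0]
      exact this
    linarith
  have hup : ω⁻¹ * (M * ‖A₀‖ * r + ω⁻¹ * M * ‖B₀‖ * N + M * M * r + ‖D‖ * r) =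
      ω⁻¹ * (ω⁻¹ * (C * N)) := by
    rw [hr', hC]; ring
  have h5 : c * ω⁻¹ * ‖y‖ ≤ ω⁻¹ * (ω⁻¹ * (C * N)) := hlow.trans (hup ▸ hy2)
  have h6 : c * ‖y‖ ≤ ω⁻¹ * (C * N) := by
    have : ω⁻¹ * (c * ‖y‖) ≤ ω⁻¹ * (ω⁻¹ * (C * N)) := by linarith
    exact le_of_mul_le_mul_left this (by positivity)
  rw [← div_eq_inv_mul, le_div_iff₀ hω0] at h6
  have h7 : C * N ≤ C * (2 * ‖y‖) := by gcongr
  have h8 : 2 * C < c * ω := by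
    have : 2 * C / c < ω := by
      have : 0 ≤ 4 * k := by positivity
      linarith
    rw [div_lt_iff₀ hc] at this
    linarith
  have hy0 : ‖y‖ ≤ 0 := by
    by_contra hcon
    push Not at hcon
    nlinarith
  funext t
  have := hN t
  have : ‖x t‖ ≤ 0 := by linarith
  simpa using this
end

/-- **Theorem 1 (existence and uniqueness part).** For the system
`dx/dt = (A₀ + ω⁻¹B₀)x + Σ_{1≤|l|≤m}(B_l x + d_l)e^{ilωt} + d₀`, where `λ = 0` is an
eigenvalue of `A₀` with eigenspace spanned by `a₁, …, a_s`, and no eigenvector of `A₀`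
for the eigenvalue `0` has a generalized adjoined vector relative to the pair
`(A₀, A₁)` with `A₁ = B₀ + Σ_{1≤|l|≤m} B_{−l}B_l/(il)`, there exists `ω₀ > 0` such that for
every `ω > ω₀` the system has exactly one `(2π/ω)`-periodic `C¹` solution `x : ℝ → ℂⁿ`. -/
theorem stmt_0
    (n m s : ℕ) (hn : 1 ≤ n) (hs : 1 ≤ s) (hsn : s ≤ n)
    (A₀ : Matrix (Fin n) (Fin n) ℂ)
    (B : ℤ → Matrix (Fin n) (Fin n) ℂ)
    (d : ℤ → Fin n → ℂ)
    (a : Fin s → Fin n → ℂ)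
    (ha_indep : LinearIndependent ℂ a)
    (ha_ker : ∀ j, A₀.mulVec (a j) = 0)
    (ha_span : ∀ v : Fin n → ℂ, A₀.mulVec v = 0 → v ∈ Submodule.span ℂ (Set.range a))
    (A₁ : Matrix (Fin n) (Fin n) ℂ)
    (hA₁ : A₁ = B 0 + ∑ l ∈ (Finset.Icc (-(m : ℤ)) (m : ℤ)).erase 0,
        (Complex.I * (l : ℂ))⁻¹ • (B (-l) * B l))
    (hnodeg : ∀ μ : Fin s → ℂ, μ ≠ 0 →
      ∀ x : Fin n → ℂ, A₀.mulVec x + A₁.mulVec (∑ j, μ j • a j) ≠ 0) :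
    ∃ ω₀ : ℝ, 0 < ω₀ ∧ ∀ ω : ℝ, ω₀ < ω →
      ∃! x : ℝ → Fin n → ℂ,
        ContDiff ℝ 1 x ∧
        (∀ t : ℝ, x (t + 2 * Real.pi / ω) = x t) ∧
        (∀ t : ℝ, deriv x t =
          (A₀ + ((ω : ℂ))⁻¹ • B 0).mulVec (x t)
          + ∑ l ∈ (Finset.Icc (-(m : ℤ)) (m : ℤ)).erase 0,
              Complex.exp (Complex.I * (l : ℂ) * (ω : ℂ) * (t : ℂ)) • ((B l).mulVec (x t) + d l)
          + d 0) := by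
  obtain ⟨S, hSdef⟩ : ∃ S, S = (Finset.Icc (-(m : ℤ)) (m : ℤ)).erase 0 := ⟨_, rfl⟩
  rw [← hSdef] at hA₁ ⊢
  have hS : (0 : ℤ) ∉ S := by rw [hSdef]; simp
  have hsym : ∀ l ∈ S, -l ∈ S := by
    intro l hl
    rw [hSdef, Finset.mem_erase, Finset.mem_Icc] at hl ⊢
    omega
  let c : Matrix (Fin n) (Fin n) ℂ → (Fin n → ℂ) →L[ℂ] (Fin n → ℂ) := fun A =>
    LinearMap.toContinuousLinearMap (Matrix.toLin' A)
  have hc : ∀ A v, c A v = A.mulVec v := fun A v => by simp [c]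
  let D : (Fin n → ℂ) →L[ℂ] (Fin n → ℂ) :=
    ∑ l ∈ S, (Complex.I * (l : ℂ))⁻¹ • ((c (B (-l))).comp (c (B l)))
  have hD : ∀ v, D v = ∑ l ∈ S, (Complex.I * (l : ℂ))⁻¹ • c (B (-l)) (c (B l) v) := by
    intro v
    simp [D]
  have hAD : ∀ v, (c (B 0) + D) v = A₁.mulVec v := by
    intro v
    rw [_root_.add_apply, hD, hA₁, Matrix.add_mulVec, Matrix.sum_mulVec, hc]
    congr 1
    refine Finset.sum_congr rfl fun l _ => ?_
    rw [hc, hc, Matrix.smul_mulVec, Matrix.mulVec_mulVec]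
  obtain ⟨ω₁, hω₁, hhom⟩ := hom_zero (fun l => c (B l)) S (c A₀) (c (B 0)) hS hsym D hD (by
    intro y hy hy0 x
    rw [hc] at hy0
    obtain ⟨μ, hμ⟩ := (Submodule.mem_span_range_iff_exists_fun ℂ).1 (ha_span y hy0)
    rw [hAD, hc, ← hμ]
    refine hnodeg μ ?_ x
    rintro rfl
    apply hy
    rw [← hμ]
    simp)
  obtain ⟨K, hK⟩ : ∃ K, K = ‖c A₀‖ + ‖c (B 0)‖ + ∑ l ∈ S, ‖c (B l)‖ := ⟨_, rfl⟩
  have hK0 : 0 ≤ K := by rw [hK]; positivity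
  have hpi := Real.pi_pos
  refine ⟨ω₁ + 4 * Real.pi * K, by positivity, fun ω hω => ?_⟩
  have h4 : 0 ≤ 4 * Real.pi * K := by positivity
  have hω0 : 0 < ω := by linarith
  have hT : 0 < 2 * Real.pi / ω := by positivity
  have hωn : ‖(ω : ℂ)⁻¹‖ ≤ 1 := by
    rw [norm_inv, Complex.norm_real, Real.norm_of_nonneg hω0.le]
    exact inv_le_one_of_one_le₀ (by linarith)
  have hFc : Continuous fun t => c A₀ + (ω : ℂ)⁻¹ • c (B 0) + Bf (fun l => c (B l)) S ω t :=
    continuous_const.add (Bf_continuous _ S ω)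
  have hgc : Continuous fun t => ∑ l ∈ S, osc ω l t • d l + d 0 :=
    (continuous_finsetSum _ fun l _ => (osc_continuous ω l).smul continuous_const).add
      continuous_const
  obtain ⟨x, ⟨hx, hxp⟩, huniq⟩ := fred hT
    (fun t => c A₀ + (ω : ℂ)⁻¹ • c (B 0) + Bf (fun l => c (B l)) S ω t) hFc
    (fun t => by
      have := Bf_periodic (fun l => c (B l)) S hω0 t
      simp only [this])
    K (fun t => by
      have h1 : ‖(ω : ℂ)⁻¹ • c (B 0)‖ ≤ ‖c (B 0)‖ := by
        rw [norm_smul]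
        exact mul_le_of_le_one_left (norm_nonneg _) hωn
      have h2 := norm_add₃_le (a := c A₀) (b := (ω : ℂ)⁻¹ • c (B 0))
        (c := Bf (fun l => c (B l)) S ω t)
      have h3 := Bf_norm (fun l => c (B l)) S ω t
      rw [hK]
      linarith)
    (by
      rw [show 2 * (2 * Real.pi / ω) * K = 4 * Real.pi * K / ω by ring, div_lt_one hω0]
      linarith)
    (hhom ω (by linarith))
    (fun t => ∑ l ∈ S, osc ω l t • d l + d 0) hgc
    (fun t => by
      have : ∀ l, osc ω l (t + 2 * Real.pi / ω) = osc ω l t := fun l => osc_periodic hω0 l t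
      simp only [this])
  have hrhs : ∀ (t : ℝ) (v : Fin n → ℂ),
      (A₀ + ((ω : ℂ))⁻¹ • B 0).mulVec v
          + ∑ l ∈ S, Complex.exp (Complex.I * (l : ℂ) * (ω : ℂ) * (t : ℂ)) • ((B l).mulVec v + d l)
          + d 0 =
      (c A₀ + (ω : ℂ)⁻¹ • c (B 0) + Bf (fun l => c (B l)) S ω t) v +
        (∑ l ∈ S, osc ω l t • d l + d 0) := by
    intro t v
    rw [_root_.add_apply, _root_.add_apply, _root_.smul_apply, Bf_apply, Matrix.add_mulVec,
      Matrix.smul_mulVec, hc, hc]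
    simp only [smul_add, Finset.sum_add_distrib, hc]
    unfold osc
    abel
  refine ⟨x, ⟨?_, hxp, fun t => ?_⟩, ?_⟩
  · have hxc : Continuous x := continuous_iff_continuousAt.2 fun t => (hx t).continuousAt
    rw [contDiff_one_iff_deriv]
    refine ⟨fun t => (hx t).differentiableAt, ?_⟩
    have : deriv x = fun t => (c A₀ + (ω : ℂ)⁻¹ • c (B 0) + Bf (fun l => c (B l)) S ω t) (x t) +
        (∑ l ∈ S, osc ω l t • d l + d 0) := funext fun t => (hx t).deriv
    rw [this]
    exact (hFc.clm_apply hxc).add hgc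
  · rw [hrhs, (hx t).deriv]
  · rintro z ⟨hz1, hz2, hz3⟩
    refine huniq z ⟨fun t => ?_, hz2⟩
    have h1 := (hz1.differentiable one_ne_zero t).hasDerivAt
    rw [hz3 t, hrhs] at h1
    exact h1
end

section
/- If in addition A₀, B₀ and d₀ are real and B_{−l} is the entrywise complex conjugate of B_l and d_{−l} is the complex conjugate of d_l for 1 ≤ l ≤ m, then there exists ω₀ > 0 such that for every ω > ω₀ the unique (2π/ω)-periodic solution x of system (1) is real-valued, i.e. x(t) ∈ ℝⁿ for all t ∈ ℝ. -/
open Matrix Finset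

theorem aux_coercive {F : Type*} [NormedAddCommGroup F] [NormedSpace ℝ F] [FiniteDimensional ℝ F]
    (A₀ A₁ : F →L[ℝ] F)
    (h : ∀ v, v ≠ 0 → A₀ v = 0 → ∀ x, A₀ x + A₁ v ≠ 0) :
    ∃ κ > 0, ∃ ε₀ > 0, ∀ ε : ℝ, 0 < ε → ε < ε₀ → ∀ v, κ * ε * ‖v‖ ≤ ‖A₀ v + ε • A₁ v‖ := by
  by_contra! hc
  have hk : ∀ k : ℕ, ∃ ε : ℝ, 0 < ε ∧ ε < 1 / ((k : ℝ) + 1) ∧ ∃ v : F, ‖v‖ = 1 ∧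
      ‖A₀ v + ε • A₁ v‖ < 1 / ((k : ℝ) + 1) * ε := by
    intro k
    obtain ⟨ε, h1, h2, v, hv⟩ := hc (1 / ((k : ℝ) + 1)) (by positivity) (1 / ((k : ℝ) + 1))
      (by positivity)
    have hv0 : v ≠ 0 := by
      rintro rfl
      simp at hv
    have hvn : 0 < ‖v‖ := norm_pos_iff.mpr hv0
    refine ⟨ε, h1, h2, ‖v‖⁻¹ • v, ?_, ?_⟩
    · rw [norm_smul, norm_inv, norm_norm, inv_mul_cancel₀ hvn.ne']
    · have : A₀ (‖v‖⁻¹ • v) + ε • A₁ (‖v‖⁻¹ • v) = ‖v‖⁻¹ • (A₀ v + ε • A₁ v) := by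
        rw [map_smul, map_smul, smul_add, smul_comm]
      rw [this, norm_smul, norm_inv, norm_norm, inv_mul_lt_iff₀ hvn]
      linarith
  choose ε hε0 hε1 v hv1 hv using hk
  have hlim : Filter.Tendsto (fun k : ℕ => 1 / ((k : ℝ) + 1)) Filter.atTop (nhds 0) :=
    tendsto_one_div_add_atTop_nhds_zero_nat
  obtain ⟨w, hw, φ, hφ, hφw⟩ := (isCompact_sphere (0 : F) 1).tendsto_subseq
    (x := v) (fun k => by simp [hv1 k])
  have hw1 : ‖w‖ = 1 := by simpa using hw
  have hε : Filter.Tendsto ε Filter.atTop (nhds 0) :=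
    squeeze_zero (fun k => (hε0 k).le) (fun k => (hε1 k).le) hlim
  have hφt := hφ.tendsto_atTop
  -- A₁ v_k + A₀ (ε⁻¹ v_k) → 0
  have hz : Filter.Tendsto (fun k => A₀ ((ε k)⁻¹ • v k) + A₁ (v k)) Filter.atTop (nhds 0) := by
    refine squeeze_zero_norm (fun k => ?_) hlim
    have : A₀ ((ε k)⁻¹ • v k) + A₁ (v k) = (ε k)⁻¹ • (A₀ (v k) + ε k • A₁ (v k)) := by
      rw [map_smul, smul_add, smul_smul, inv_mul_cancel₀ (hε0 k).ne', one_smul]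
    rw [this, norm_smul, norm_inv, Real.norm_of_nonneg (hε0 k).le, inv_mul_le_iff₀ (hε0 k)]
    linarith [hv k]
  have hA1 : Filter.Tendsto (fun k => A₁ (v (φ k))) Filter.atTop (nhds (A₁ w)) :=
    (A₁.continuous.tendsto w).comp hφw
  have hA0 : Filter.Tendsto (fun k => A₀ (v (φ k))) Filter.atTop (nhds (A₀ w)) :=
    (A₀.continuous.tendsto w).comp hφw
  have hr : Filter.Tendsto (fun k => A₀ ((ε (φ k))⁻¹ • v (φ k))) Filter.atTop
      (nhds (0 - A₁ w)) := by
    have := (hz.comp hφt).sub hA1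
    refine this.congr (fun k => ?_)
    simp
  have hAw : A₀ w = 0 := by
    have h1 : Filter.Tendsto (fun k => ε (φ k) • A₀ ((ε (φ k))⁻¹ • v (φ k))) Filter.atTop
      (nhds ((0:ℝ) • (0 - A₁ w))) := (hε.comp hφt).smul hr
    rw [zero_smul] at h1
    refine tendsto_nhds_unique hA0 (h1.congr (fun k => ?_))
    rw [map_smul, smul_smul, mul_inv_cancel₀ (hε0 _).ne', one_smul]
  have hcl : IsClosed ((LinearMap.range (A₀ : F →ₗ[ℝ] F) : Submodule ℝ F) : Set F) :=
    Submodule.closed_of_finiteDimensional _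
  have hmem : (0 - A₁ w) ∈ ((LinearMap.range (A₀ : F →ₗ[ℝ] F) : Submodule ℝ F) : Set F) :=
    hcl.mem_of_tendsto hr (Filter.Eventually.of_forall fun k => ⟨_, rfl⟩)
  obtain ⟨x, hx⟩ := hmem
  have hx' : A₀ x = 0 - A₁ w := hx
  refine h w (by rintro rfl; simp at hw1) hAw x ?_
  rw [hx']; simp

theorem aux_unique {F : Type*} [NormedAddCommGroup F] [NormedSpace ℝ F] [FiniteDimensional ℝ F]
    (A₀ B₀ S : F →L[ℝ] F) (P Q : ℝ → F →L[ℝ] F) (p q : ℝ)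
    (hP : ∀ t, HasDerivAt P (Q t) t) (hQc : Continuous Q)
    (hPper : ∀ t, P (t + 2 * Real.pi) = P t)
    (hp : ∀ t, ‖P t‖ ≤ p) (hq : ∀ t, ‖Q t‖ ≤ q)
    (hPm : ∀ v, ∫ t in (0:ℝ)..(2 * Real.pi), P t v = 0)
    (hPQ : ∀ v, ∫ t in (0:ℝ)..(2 * Real.pi), P t (Q t v) = -((2 * Real.pi) • S v))
    (h : ∀ v, v ≠ 0 → A₀ v = 0 → ∀ x, A₀ x + (B₀ + S) v ≠ 0) :
    ∃ ε₀ > 0, ∀ ε : ℝ, 0 < ε → ε < ε₀ → ∀ u : ℝ → F,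
      (∀ t, HasDerivAt u (ε • (A₀ (u t) + ε • B₀ (u t) + Q t (u t))) t) →
      (∀ t, u (t + 2 * Real.pi) = u t) → u = 0 := by
  obtain ⟨κ, hκ, ε₁, hε₁, hco⟩ := aux_coercive A₀ (B₀ + S) h
  have hp0 : 0 ≤ p := (norm_nonneg _).trans (hp 0)
  have hq0 : 0 ≤ q := (norm_nonneg _).trans (hq 0)
  have hpi := Real.pi_pos
  set K := ‖A₀‖ + ‖B₀‖ + q with hK
  have hK0 : 0 ≤ K := by positivity
  set C := 2 * Real.pi * K with hC
  have hC0 : 0 ≤ C := by positivity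
  set C₂ := (‖B₀‖ + p * ‖A₀‖ + p * q) * C + p * ‖B₀‖ with hC₂
  have hC20 : 0 ≤ C₂ := by positivity
  refine ⟨min ε₁ (min 1 (min (1 / (2 * C + 1)) (κ / (2 * C₂ + 1)))), by positivity, ?_⟩
  intro ε hε hεlt u hu huper
  simp only [lt_min_iff] at hεlt
  obtain ⟨hε1, hεone, hεC, hεκ⟩ := hεlt
  rw [lt_div_iff₀ (by positivity)] at hεC hεκ
  have huc : Continuous u := continuous_iff_continuousAt.mpr fun t => (hu t).continuousAt
  have hPc : Continuous P := continuous_iff_continuousAt.mpr fun t => (hP t).continuousAt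
  -- sup bound
  obtain ⟨t₁, -, ht₁⟩ := isCompact_Icc.exists_isMaxOn (s := Set.Icc (0:ℝ) (2 * Real.pi))
    ⟨0, by constructor <;> positivity⟩ huc.norm.continuousOn
  set N := ‖u t₁‖ with hN
  have hper : Function.Periodic u (2 * Real.pi) := huper
  have hNb : ∀ t, ‖u t‖ ≤ N := by
    intro t
    obtain ⟨y, hy, hyt⟩ := hper.exists_mem_Ico₀ (by positivity) t
    rw [hyt]
    exact ht₁ (Set.Ico_subset_Icc_self hy)
  have hN0 : 0 ≤ N := norm_nonneg _
  have hop : ∀ (T : F →L[ℝ] F) (τ : ℝ) (x : F) (X : ℝ), ‖T‖ ≤ τ → ‖x‖ ≤ X → ‖T x‖ ≤ τ * X :=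
    fun T τ x X h1 h2 => T.le_of_opNorm_le_of_le h1 h2
  have hder : ∀ t, ‖ε • (A₀ (u t) + ε • B₀ (u t) + Q t (u t))‖ ≤ ε * (K * N) := by
    intro t
    rw [norm_smul, Real.norm_of_nonneg hε.le]
    refine mul_le_mul_of_nonneg_left ?_ hε.le
    have h1 := hop A₀ _ _ _ le_rfl (hNb t)
    have h2 : ‖ε • B₀ (u t)‖ ≤ ‖B₀‖ * N := by
      rw [norm_smul, Real.norm_of_nonneg hε.le]
      have := hop B₀ _ _ _ le_rfl (hNb t)
      calc ε * ‖B₀ (u t)‖ ≤ 1 * ‖B₀ (u t)‖ := by gcongr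
        _ ≤ _ := by linarith
    have h3 := hop (Q t) _ _ _ (hq t) (hNb t)
    calc _ ≤ ‖A₀ (u t)‖ + ‖ε • B₀ (u t)‖ + ‖Q t (u t)‖ := norm_add₃_le
      _ ≤ _ := by rw [hK]; linarith
  have hlip : ∀ s t, ‖u t - u s‖ ≤ ε * (K * N) * ‖t - s‖ := fun s t =>
    convex_univ.norm_image_sub_le_of_norm_hasDerivWithin_le
      (fun x _ => (hu x).hasDerivWithinAt) (fun x _ => hder x) (Set.mem_univ s) (Set.mem_univ t)
  -- mean
  set v : F := (2 * Real.pi)⁻¹ • ∫ t in (0:ℝ)..(2 * Real.pi), u t with hv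
  have h2v : ∫ t in (0:ℝ)..(2 * Real.pi), u t = (2 * Real.pi) • v := by
    rw [hv, smul_smul, mul_inv_cancel₀ (by positivity), one_smul]
  have hw : ∀ t ∈ Set.Icc (0:ℝ) (2 * Real.pi), ‖u t - v‖ ≤ C * ε * N := by
    intro t ht
    have e1 : ∫ s in (0:ℝ)..(2 * Real.pi), (u t - u s) = (2 * Real.pi) • (u t - v) := by
      rw [intervalIntegral.integral_sub (by simp) (huc.intervalIntegrable _ _), h2v]
      simp [smul_sub]
    have e2 : ‖∫ s in (0:ℝ)..(2 * Real.pi), (u t - u s)‖ ≤ (C * ε * N) * |2 * Real.pi - 0| := by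
      refine intervalIntegral.norm_integral_le_of_norm_le_const fun s hs => ?_
      rw [Set.uIoc_of_le (by positivity)] at hs
      refine (hlip s t).trans ?_
      have : ‖t - s‖ ≤ 2 * Real.pi := by
        rw [Real.norm_eq_abs, abs_le]
        constructor <;> linarith [hs.1, hs.2, ht.1, ht.2]
      calc _ ≤ ε * (K * N) * (2 * Real.pi) := by gcongr
        _ = _ := by rw [hC]; ring
    rw [e1, norm_smul, sub_zero, abs_of_pos (by positivity), Real.norm_of_nonneg (by positivity),
      mul_comm (C * ε * N)] at e2
    exact le_of_mul_le_mul_left e2 (by positivity)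
  -- the averaged identity
  have hAu : Continuous fun t => A₀ (u t) := by fun_prop
  have hBu : Continuous fun t => B₀ (u t) := by fun_prop
  have hQu : Continuous fun t => Q t (u t) := by fun_prop
  have i1 : ∫ t in (0:ℝ)..(2 * Real.pi), ε • (A₀ (u t) + ε • B₀ (u t) + Q t (u t)) = 0 := by
    rw [intervalIntegral.integral_eq_sub_of_hasDerivAt (fun t _ => hu t)
      ((by fun_prop : Continuous _).intervalIntegrable _ _)]
    have := huper 0
    rw [zero_add] at this
    rw [this, sub_self]
  have i2 : ∫ t in (0:ℝ)..(2 * Real.pi), (Q t (u t) +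
      P t (ε • (A₀ (u t) + ε • B₀ (u t) + Q t (u t)))) = 0 := by
    rw [intervalIntegral.integral_eq_sub_of_hasDerivAt (fun t _ => (hP t).clm_apply (hu t))
      ((by fun_prop : Continuous _).intervalIntegrable _ _)]
    have := huper 0
    have h' := hPper 0
    rw [zero_add] at this h'
    rw [this, h', sub_self]
  have i1' : ∫ t in (0:ℝ)..(2 * Real.pi), (A₀ (u t) + ε • B₀ (u t) + Q t (u t)) = 0 := by
    rw [intervalIntegral.integral_smul] at i1
    exact (smul_eq_zero.mp i1).resolve_left hε.ne'
  have i3 : ∫ t in (0:ℝ)..(2 * Real.pi), A₀ (u t) = (2 * Real.pi) • A₀ v := by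
    rw [A₀.intervalIntegral_comp_comm (huc.intervalIntegrable _ _), h2v, map_smul]
  set D : ℝ → F := fun t => B₀ (u t - v) - P t (A₀ (u t - v)) - P t (Q t (u t - v))
    - ε • P t (B₀ (u t)) with hD
  have hDc : Continuous D := by rw [hD]; fun_prop
  have hDb : ‖∫ t in (0:ℝ)..(2 * Real.pi), D t‖ ≤ (ε * (C₂ * N)) * |2 * Real.pi - 0| := by
    refine intervalIntegral.norm_integral_le_of_norm_le_const fun t ht => ?_
    rw [Set.uIoc_of_le (by positivity)] at ht
    have hwt := hw t (Set.Ioc_subset_Icc_self ht)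
    have b1 := hop B₀ _ _ _ le_rfl hwt
    have b2 := hop (P t) _ _ _ (hp t) (hop A₀ _ _ _ le_rfl hwt)
    have b3 := hop (P t) _ _ _ (hp t) (hop (Q t) _ _ _ (hq t) hwt)
    have b4 : ‖ε • P t (B₀ (u t))‖ ≤ ε * (p * (‖B₀‖ * N)) := by
      rw [norm_smul, Real.norm_of_nonneg hε.le]
      exact mul_le_mul_of_nonneg_left (hop (P t) _ _ _ (hp t) (hop B₀ _ _ _ le_rfl (hNb t))) hε.le
    calc ‖D t‖ ≤ ‖B₀ (u t - v)‖ + ‖P t (A₀ (u t - v))‖ + ‖P t (Q t (u t - v))‖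
          + ‖ε • P t (B₀ (u t))‖ := by
            refine (norm_sub_le _ _).trans (add_le_add_left ?_ _)
            refine (norm_sub_le _ _).trans (add_le_add_left ?_ _)
            exact norm_sub_le _ _
      _ ≤ _ := by rw [hC₂]; nlinarith
  have key : (2 * Real.pi) • (A₀ v + ε • (B₀ + S) v) = - (ε • ∫ t in (0:ℝ)..(2 * Real.pi), D t) := by
    have c1 : ∫ t in (0:ℝ)..(2 * Real.pi), (A₀ (u t) + ε • (D t + (B₀ v - P t (A₀ v)
        - P t (Q t v)))) = 0 := by
      have := i1'
      rw [← sub_eq_zero.mpr (i1'.trans i2.symm), ← intervalIntegral.integral_sub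
        ((by fun_prop : Continuous _).intervalIntegrable _ _)
        ((by fun_prop : Continuous _).intervalIntegrable _ _)]
      congr 1
      ext t
      simp only [hD, map_sub, map_add, map_smul, smul_add, smul_sub]
      module
    have cB : ∫ t in (0:ℝ)..(2 * Real.pi), (B₀ v - P t (A₀ v) - P t (Q t v)) =
        (2 * Real.pi) • B₀ v + (2 * Real.pi) • S v := by
      rw [intervalIntegral.integral_sub
        ((by fun_prop : Continuous _).intervalIntegrable _ _)
        ((by fun_prop : Continuous _).intervalIntegrable _ _),
        intervalIntegral.integral_sub
        ((by fun_prop : Continuous _).intervalIntegrable _ _)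
        ((by fun_prop : Continuous _).intervalIntegrable _ _), hPm, hPQ,
        intervalIntegral.integral_const]
      simp
    clear_value D
    rw [intervalIntegral.integral_add
        ((by fun_prop : Continuous _).intervalIntegrable _ _)
        ((by fun_prop : Continuous _).intervalIntegrable _ _), intervalIntegral.integral_smul,
      intervalIntegral.integral_add
        ((by fun_prop : Continuous _).intervalIntegrable _ _)
        ((by fun_prop : Continuous _).intervalIntegrable _ _),
      cB, i3] at c1
    rw [eq_neg_iff_add_eq_zero, ← c1]
    simp only [_root_.add_apply]
    module
  have kn : ‖A₀ v + ε • (B₀ + S) v‖ ≤ ε * (ε * (C₂ * N)) := by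
    have := congrArg norm key
    rw [norm_smul, norm_neg, norm_smul, Real.norm_of_nonneg hε.le,
      Real.norm_of_nonneg (by positivity)] at this
    rw [sub_zero, abs_of_pos (by positivity)] at hDb
    have h3 : 2 * Real.pi * ‖A₀ v + ε • (B₀ + S) v‖ ≤ 2 * Real.pi * (ε * (ε * (C₂ * N))) := by
      rw [this]
      calc _ ≤ ε * (ε * (C₂ * N) * (2 * Real.pi)) := by gcongr
        _ = _ := by ring
    exact le_of_mul_le_mul_left h3 (by positivity)
  have hcv := (hco ε hε hε1 v).trans kn
  have hcv' : κ * ‖v‖ ≤ ε * C₂ * N := by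
    refine le_of_mul_le_mul_left ?_ hε
    linarith
  have hNv : N ≤ 2 * ‖v‖ := by
    obtain ⟨y, hy, hyt⟩ := hper.exists_mem_Ico₀ (by positivity) t₁
    have h1 := hw y (Set.Ico_subset_Icc_self hy)
    have h2 : N ≤ ‖v‖ + C * ε * N := by
      have hNy : N = ‖u y‖ := by rw [hN, hyt]
      have h3 : ‖u y‖ ≤ ‖v‖ + ‖u y - v‖ := by
        calc ‖u y‖ = ‖v + (u y - v)‖ := by congr 1; abel
          _ ≤ _ := norm_add_le _ _
      linarith
    nlinarith
  have hNz : N = 0 := by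
    have hv0 : ‖v‖ ≤ 0 := by
      by_contra! hpos
      have : ε * C₂ * N ≤ ε * C₂ * (2 * ‖v‖) := by gcongr
      nlinarith
    linarith
  ext t
  have := hNb t
  rw [hNz] at this
  simpa using norm_le_zero_iff.mp this


instance aux_fact : Fact (0 < 2 * Real.pi) := ⟨Real.two_pi_pos⟩

/-- mean value of a function on the circle -/
noncomputable def auxMean {F : Type*} [NormedAddCommGroup F] [NormedSpace ℝ F] 
    (g : C(AddCircle (2 * Real.pi), F)) : F :=
  (2 * Real.pi)⁻¹ • ∫ t in (0:ℝ)..(2 * Real.pi), g (t : AddCircle (2 * Real.pi))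

theorem aux_cont {F : Type*} [NormedAddCommGroup F]
    (g : C(AddCircle (2 * Real.pi), F)) :
    Continuous fun t : ℝ => g (t : AddCircle (2 * Real.pi)) :=
  g.continuous.comp (AddCircle.continuous_mk' _)

theorem auxMean_add {F : Type*} [NormedAddCommGroup F] [NormedSpace ℝ F]
    (g h : C(AddCircle (2 * Real.pi), F)) : auxMean (g + h) = auxMean g + auxMean h := by
  simp only [auxMean, ContinuousMap.add_apply]
  rw [intervalIntegral.integral_add ((aux_cont g).intervalIntegrable _ _)
    ((aux_cont h).intervalIntegrable _ _), smul_add]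

theorem auxMean_smul {F : Type*} [NormedAddCommGroup F] [NormedSpace ℝ F]
    (c : ℝ) (g : C(AddCircle (2 * Real.pi), F)) : auxMean (c • g) = c • auxMean g := by
  simp only [auxMean, ContinuousMap.smul_apply]
  rw [intervalIntegral.integral_smul, smul_comm]

theorem auxMean_norm {F : Type*} [NormedAddCommGroup F] [NormedSpace ℝ F]
    (g : C(AddCircle (2 * Real.pi), F)) : ‖auxMean g‖ ≤ ‖g‖ := by
  have h := intervalIntegral.norm_integral_le_of_norm_le_const (a := 0) (b := 2 * Real.pi)
    (f := fun t : ℝ => g (t : AddCircle (2 * Real.pi))) (C := ‖g‖) (fun t _ => g.norm_coe_le_norm _)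
  have hpi := Real.two_pi_pos
  rw [sub_zero, abs_of_pos hpi] at h
  rw [auxMean, norm_smul, norm_inv, Real.norm_of_nonneg hpi.le, inv_mul_le_iff₀ hpi]
  linarith

/-- antiderivative on the line -/
noncomputable def auxPrim {F : Type*} [NormedAddCommGroup F] [NormedSpace ℝ F] 
    (g : C(AddCircle (2 * Real.pi), F)) (x : ℝ) : F :=
  ∫ t in (0:ℝ)..x, (g (t : AddCircle (2 * Real.pi)) - auxMean g)

theorem auxPrim_deriv {F : Type*} [NormedAddCommGroup F] [NormedSpace ℝ F] [CompleteSpace F]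
    (g : C(AddCircle (2 * Real.pi), F)) (x : ℝ) :
    HasDerivAt (auxPrim g) (g (x : AddCircle (2 * Real.pi)) - auxMean g) x := by
  have hc : Continuous fun t : ℝ => g (t : AddCircle (2 * Real.pi)) - auxMean g :=
    (aux_cont g).sub continuous_const
  exact hc.integral_hasStrictDerivAt 0 x |>.hasDerivAt

theorem auxPrim_periodic {F : Type*} [NormedAddCommGroup F] [NormedSpace ℝ F] [CompleteSpace F]
    (g : C(AddCircle (2 * Real.pi), F)) : Function.Periodic (auxPrim g) (2 * Real.pi) := by
  intro x
  have hc : Continuous fun t : ℝ => g (t : AddCircle (2 * Real.pi)) - auxMean g :=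
    (aux_cont g).sub continuous_const
  have hper : Function.Periodic (fun t : ℝ => g (t : AddCircle (2 * Real.pi)) - auxMean g)
      (2 * Real.pi) := by
    intro t
    simp
  have h0 : ∫ t in (0:ℝ)..(2 * Real.pi), (g (t : AddCircle (2 * Real.pi)) - auxMean g) = 0 := by
    rw [intervalIntegral.integral_sub ((aux_cont g).intervalIntegrable _ _) (by simp),
      intervalIntegral.integral_const, auxMean, smul_smul, sub_zero,
      mul_inv_cancel₀ Real.two_pi_pos.ne', one_smul, sub_self]
  unfold auxPrim
  rw [← intervalIntegral.integral_add_adjacent_intervals (hc.intervalIntegrable 0 x)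
    (hc.intervalIntegrable x _), hper.intervalIntegral_add_eq x 0, zero_add, h0, add_zero]

theorem auxPrim_continuous {F : Type*} [NormedAddCommGroup F] [NormedSpace ℝ F] [CompleteSpace F]
    (g : C(AddCircle (2 * Real.pi), F)) : Continuous (auxPrim g) :=
  continuous_iff_continuousAt.mpr fun t => (auxPrim_deriv g t).continuousAt

/-- antiderivative on the circle, as a continuous linear map -/
noncomputable def auxV {F : Type*} [NormedAddCommGroup F] [NormedSpace ℝ F] [CompleteSpace F] :
    C(AddCircle (2 * Real.pi), F) →L[ℝ] C(AddCircle (2 * Real.pi), F) :=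
  LinearMap.mkContinuous
    { toFun := fun g => ⟨(auxPrim_periodic g).lift, (auxPrim_continuous g).quotient_lift _⟩
      map_add' := fun g h => by
        ext x
        induction x using QuotientAddGroup.induction_on with | _ x
        change auxPrim (g + h) x = auxPrim g x + auxPrim h x
        unfold auxPrim
        have hi : ∀ g : C(AddCircle (2 * Real.pi), F), IntervalIntegrable
            (fun t : ℝ => g (t : AddCircle (2 * Real.pi)) - auxMean g) MeasureTheory.volume 0 x :=
          fun g => ((aux_cont g).sub continuous_const).intervalIntegrable _ _
        rw [← intervalIntegral.integral_add (hi g) (hi h)]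
        congr 1
        ext t
        rw [auxMean_add, ContinuousMap.add_apply]
        abel
      map_smul' := fun c g => by
        ext x
        induction x using QuotientAddGroup.induction_on with | _ x
        change auxPrim (c • g) x = c • auxPrim g x
        unfold auxPrim
        rw [← intervalIntegral.integral_smul]
        congr 1
        ext t
        rw [auxMean_smul, ContinuousMap.smul_apply, smul_sub] }
    (4 * Real.pi) (fun g => by
      have hpi := Real.pi_pos
      refine (ContinuousMap.norm_le _ (by positivity)).mpr fun x => ?_
      induction x using QuotientAddGroup.induction_on with | _ x
      change ‖auxPrim g x‖ ≤ _
      obtain ⟨y, hy, hxy⟩ := (auxPrim_periodic g).exists_mem_Ico₀ Real.two_pi_pos x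
      rw [hxy]
      have h := intervalIntegral.norm_integral_le_of_norm_le_const (a := 0) (b := y)
        (f := fun t : ℝ => g (t : AddCircle (2 * Real.pi)) - auxMean g) (C := 2 * ‖g‖)
        (fun t _ => (norm_sub_le _ _).trans
          (by linarith [g.norm_coe_le_norm (t : AddCircle (2 * Real.pi)), auxMean_norm g]))
      rw [sub_zero, abs_of_nonneg hy.1] at h
      refine h.trans ?_
      have := hy.2
      have h0 := norm_nonneg g
      nlinarith)

theorem auxV_apply {F : Type*} [NormedAddCommGroup F] [NormedSpace ℝ F] [CompleteSpace F]
    (g : C(AddCircle (2 * Real.pi), F)) (x : ℝ) :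
    auxV g (x : AddCircle (2 * Real.pi)) = auxPrim g x := rfl

theorem auxV_norm {F : Type*} [NormedAddCommGroup F] [NormedSpace ℝ F] [CompleteSpace F] :
    ‖(auxV : C(AddCircle (2 * Real.pi), F) →L[ℝ] C(AddCircle (2 * Real.pi), F))‖
      ≤ 4 * Real.pi :=
  LinearMap.mkContinuous_norm_le _ (by positivity) _

theorem aux_exists {F : Type*} [NormedAddCommGroup F] [NormedSpace ℝ F] [FiniteDimensional ℝ F]
    (L : ℝ → F →L[ℝ] F) (f : ℝ → F) (hLc : Continuous L) (hfc : Continuous f)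
    (hLper : ∀ t, L (t + 2 * Real.pi) = L t) (hfper : ∀ t, f (t + 2 * Real.pi) = f t)
    (K ε : ℝ) (hK : ∀ t, ‖L t‖ ≤ K) (hε : 0 < ε) (hεK : ε * (4 * Real.pi * K) < 1)
    (huniq : ∀ u : ℝ → F, (∀ t, HasDerivAt u (ε • (L t (u t))) t) →
      (∀ t, u (t + 2 * Real.pi) = u t) → u = 0) :
    ∃ u : ℝ → F, (∀ t, HasDerivAt u (ε • (L t (u t) + f t)) t) ∧
      (∀ t, u (t + 2 * Real.pi) = u t) := by
  have : CompleteSpace F := FiniteDimensional.complete ℝ F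
  have hpi := Real.pi_pos
  have hK0 : 0 ≤ K := (norm_nonneg _).trans (hK 0)
  have hLp : Function.Periodic L (2 * Real.pi) := hLper
  have hfp : Function.Periodic f (2 * Real.pi) := hfper
  let Lc : C(AddCircle (2 * Real.pi), F →L[ℝ] F) := ⟨hLp.lift, hLc.quotient_lift _⟩
  let fc : C(AddCircle (2 * Real.pi), F) := ⟨hfp.lift, hfc.quotient_lift _⟩
  have hLcn : ∀ x, ‖Lc x‖ ≤ K := by
    intro x
    induction x using QuotientAddGroup.induction_on with | _ x
    exact hK x
  let M : C(AddCircle (2 * Real.pi), F) →L[ℝ] C(AddCircle (2 * Real.pi), F) :=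
    LinearMap.mkContinuous
      { toFun := fun g => ⟨fun x => Lc x (g x), by fun_prop⟩
        map_add' := fun g h => by ext x; simp
        map_smul' := fun c g => by ext x; simp } K (fun g => by
          refine (ContinuousMap.norm_le _ (by positivity)).mpr fun x => ?_
          exact (Lc x).le_of_opNorm_le_of_le (hLcn x) (g.norm_coe_le_norm x))
  have hMn : ‖M‖ ≤ K := LinearMap.mkContinuous_norm_le _ hK0 _
  have hM : ∀ g (t : ℝ), M g (t : AddCircle (2 * Real.pi)) = L t (g t) := fun g t => rfl
  have hfcx : ∀ t : ℝ, fc (t : AddCircle (2 * Real.pi)) = f t := fun t => rfl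
  let T : C(AddCircle (2 * Real.pi), F) →L[ℝ] C(AddCircle (2 * Real.pi), F) :=
    ε • (auxV.comp M)
  have hT : ‖T‖ < 1 := by
    calc ‖T‖ = ε * ‖auxV.comp M‖ := by
          simp only [T]; rw [norm_smul, Real.norm_of_nonneg hε.le]
      _ ≤ ε * (4 * Real.pi * K) := by
          gcongr
          refine (ContinuousLinearMap.opNorm_comp_le _ _).trans ?_
          gcongr
          exact auxV_norm
      _ < 1 := hεK
  obtain ⟨U, hU⟩ := isUnit_one_sub_of_norm_lt_one hT
  let R : C(AddCircle (2 * Real.pi), F) →L[ℝ] C(AddCircle (2 * Real.pi), F) := ↑U⁻¹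
  have hR : ∀ g, R g = g + ε • auxV (M (R g)) := by
    intro g
    have h1 : (1 - T) * R = 1 := by rw [← hU]; exact U.mul_inv
    have h2 := congrArg (fun Z => Z g) h1
    have h3 : R g - ε • auxV (M (R g)) = g := h2
    exact sub_eq_iff_eq_add.mp h3
  -- solution from a vector with vanishing mean
  have hsol : ∀ (g : C(AddCircle (2 * Real.pi), F)) (c : F)
      (x : C(AddCircle (2 * Real.pi), F)), auxMean g = 0 → 
      x = ContinuousMap.const _ c + ε • auxV g → 
      ∀ t : ℝ, HasDerivAt (fun s : ℝ => x (s : AddCircle (2 * Real.pi)))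
        (ε • g (t : AddCircle (2 * Real.pi))) t := by
    intro g c x hm hx t
    have h1 := ((auxPrim_deriv g t).const_smul ε).const_add c
    rw [hm, sub_zero] at h1
    have : (fun s : ℝ => x (s : AddCircle (2 * Real.pi))) = fun s => c + ε • auxPrim g s := by
      ext s
      rw [hx]
      rfl
    rw [this]
    exact h1
  have hxper : ∀ (x : C(AddCircle (2 * Real.pi), F)) (t : ℝ),
      x ((t + 2 * Real.pi : ℝ) : AddCircle (2 * Real.pi)) = x (t : AddCircle (2 * Real.pi)) := by
    intro x t
    simp
  let J : F →ₗ[ℝ] F :=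
    { toFun := fun c => auxMean (M (R (ContinuousMap.const _ c)))
      map_add' := fun c c' => by
        rw [← auxMean_add, ← map_add, ← map_add]; rfl
      map_smul' := fun r c => by
        rw [RingHom.id_apply, ← auxMean_smul, ← map_smul, ← map_smul]; rfl }
  have hJ : Function.Injective J := by
    rw [injective_iff_map_eq_zero]
    intro c hc
    have hc' : auxMean (M (R (ContinuousMap.const _ c))) = 0 := hc
    have h1 := hsol _ c _ hc' (hR _)
    have h2 := huniq _ h1 (hxper _)
    have h3 : R (ContinuousMap.const _ c) = 0 := by
      ext x
      induction x using QuotientAddGroup.induction_on with | _ x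
      exact congrFun h2 x
    have h4 := hR (ContinuousMap.const _ c)
    rw [h3, map_zero, map_zero, smul_zero, add_zero] at h4
    exact (congrArg (fun g => g 0) h4).symm
  obtain ⟨c, hc⟩ := (LinearMap.injective_iff_surjective.mp hJ)
    (-(auxMean (M (R (ε • auxV fc))) + auxMean fc))
  have hc' : auxMean (M (R (ContinuousMap.const _ c))) = _ := hc
  set x := R (ContinuousMap.const _ c + ε • auxV fc) with hx
  have hm : auxMean (M x + fc) = 0 := by
    rw [hx, map_add, map_add, auxMean_add, auxMean_add, hc']
    abel
  have hxe : x = ContinuousMap.const _ c + ε • auxV (M x + fc) := by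
    rw [map_add, smul_add, add_comm (ε • auxV (M x)), ← add_assoc]
    exact hR _
  exact ⟨fun s => x s, fun t => hsol _ c x hm hxe t, hxper x⟩

/-- real-linear continuous map attached to a complex matrix -/
noncomputable def auxMv {n : ℕ} (A : Matrix (Fin n) (Fin n) ℂ) :
    (Fin n → ℂ) →L[ℝ] (Fin n → ℂ) :=
  LinearMap.toContinuousLinearMap ((Matrix.mulVecLin A).restrictScalars ℝ)

theorem auxMv_apply {n : ℕ} (A : Matrix (Fin n) (Fin n) ℂ) (v : Fin n → ℂ) :
    auxMv A v = A.mulVec v := rfl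

/-- Fourier exponentials -/
noncomputable def auxE (l : ℤ) (t : ℝ) : ℂ := Complex.exp (Complex.I * (l : ℂ) * (t : ℂ))

theorem auxE_norm (l : ℤ) (t : ℝ) : ‖auxE l t‖ = 1 := by
  have : Complex.I * (l : ℂ) * (t : ℂ) = ((l * t : ℝ) : ℂ) * Complex.I := by push_cast; ring
  rw [auxE, this, Complex.norm_exp_ofReal_mul_I]

theorem auxE_add (l k : ℤ) (t : ℝ) : auxE l t * auxE k t = auxE (l + k) t := by
  rw [auxE, auxE, auxE, ← Complex.exp_add]
  congr 1
  push_cast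
  ring

theorem auxE_star (l : ℤ) (t : ℝ) : star (auxE l t) = auxE (-l) t := by
  rw [auxE, auxE, ← starRingEnd_apply, ← Complex.exp_conj]
  congr 1
  simp

theorem auxE_per (l : ℤ) (t : ℝ) : auxE l (t + 2 * Real.pi) = auxE l t := by
  rw [auxE, auxE]
  have : Complex.I * (l : ℂ) * ((t + 2 * Real.pi : ℝ) : ℂ) =
    Complex.I * (l : ℂ) * (t : ℂ) + l * (2 * Real.pi * Complex.I) := by push_cast; ring
  rw [this, Complex.exp_add, Complex.exp_int_mul_two_pi_mul_I, mul_one]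

theorem auxE_deriv (l : ℤ) (t : ℝ) :
    HasDerivAt (auxE l) (auxE l t * (Complex.I * (l : ℂ))) t := by
  have h1 : HasDerivAt (fun t : ℝ => Complex.I * (l : ℂ) * (t : ℂ)) (Complex.I * (l : ℂ)) t := by
    simpa using (Complex.ofRealCLM.hasDerivAt (x := t)).const_mul (Complex.I * (l : ℂ))
  exact h1.cexp

theorem auxE_cont (l : ℤ) : Continuous (auxE l) :=
  continuous_iff_continuousAt.mpr fun t => (auxE_deriv l t).continuousAt

theorem auxE_int (l : ℤ) :
    ∫ t in (0:ℝ)..(2 * Real.pi), auxE l t = if l = 0 then ((2 * Real.pi : ℝ) : ℂ) else 0 := by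
  split_ifs with h
  · subst h
    simp [auxE]
  · have hl : Complex.I * (l : ℂ) ≠ 0 := mul_ne_zero Complex.I_ne_zero (by exact_mod_cast h)
    have h1 : ∀ t : ℝ, HasDerivAt (fun t => auxE l t * (Complex.I * (l : ℂ))⁻¹) (auxE l t) t := by
      intro t
      have := (auxE_deriv l t).mul_const (Complex.I * (l : ℂ))⁻¹
      rwa [mul_assoc, mul_inv_cancel₀ hl, mul_one] at this
    rw [intervalIntegral.integral_eq_sub_of_hasDerivAt (fun t _ => h1 t)
      ((auxE_cont l).intervalIntegrable _ _)]
    have := auxE_per l 0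
    rw [zero_add] at this
    rw [this, sub_self]

theorem auxE_int_smul {n : ℕ} (l : ℤ) (v : Fin n → ℂ) :
    ∫ t in (0:ℝ)..(2 * Real.pi), auxE l t • v =
      if l = 0 then (2 * Real.pi) • v else 0 := by
  rw [intervalIntegral.integral_smul_const, auxE_int]
  split_ifs
  · ext i
    simp
  · simp

theorem aux_sum_neg {M : Type*} [AddCommMonoid M] (m : ℕ) (g : ℤ → M) :
    ∑ l ∈ (Finset.Icc (-(m : ℤ)) (m : ℤ)).erase 0, g (-l) =
      ∑ l ∈ (Finset.Icc (-(m : ℤ)) (m : ℤ)).erase 0, g l := by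
  refine Finset.sum_nbij' (fun l => -l) (fun l => -l) ?_ ?_ ?_ ?_ ?_
  · intro l hl
    simp only [Finset.mem_erase, Finset.mem_Icc] at hl ⊢
    omega
  · intro l hl
    simp only [Finset.mem_erase, Finset.mem_Icc] at hl ⊢
    omega
  · simp
  · simp
  · simp

theorem aux_star_mulVec {n : ℕ} (A : Matrix (Fin n) (Fin n) ℂ) (v : Fin n → ℂ) :
    star (A.mulVec v) = (A.map (starRingEnd ℂ)).mulVec (star v) := by
  ext i
  simp [Matrix.mulVec, dotProduct]

/-- If in addition `A₀`, `B₀`, `d₀` are real and `B_{−l} = conj(B_l)`, `d_{−l} = conj(d_l)`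
for `1 ≤ l ≤ m`, then there exists `ω₀ > 0` such that for every `ω > ω₀` the unique
`(2π/ω)`-periodic solution `x` of the system
`dx/dt = (A₀ + ω⁻¹B₀)x + Σ_{1≤|l|≤m}(B_l x + d_l)e^{ilωt} + d₀` is real-valued. -/
theorem stmt_17
    (n m s : ℕ) (hn : 1 ≤ n) (hs : 1 ≤ s) (hsn : s ≤ n)
    (A₀ : Matrix (Fin n) (Fin n) ℂ)
    (B : ℤ → Matrix (Fin n) (Fin n) ℂ)
    (d : ℤ → Fin n → ℂ)
    (a : Fin s → Fin n → ℂ)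
    (ha_indep : LinearIndependent ℂ a)
    (ha_ker : ∀ j, A₀.mulVec (a j) = 0)
    (ha_span : ∀ v : Fin n → ℂ, A₀.mulVec v = 0 → v ∈ Submodule.span ℂ (Set.range a))
    (A₁ : Matrix (Fin n) (Fin n) ℂ)
    (hA₁ : A₁ = B 0 + ∑ l ∈ (Finset.Icc (-(m : ℤ)) (m : ℤ)).erase 0,
        (Complex.I * (l : ℂ))⁻¹ • (B (-l) * B l))
    (hnodeg : ∀ μ : Fin s → ℂ, μ ≠ 0 →
      ∀ x : Fin n → ℂ, A₀.mulVec x + A₁.mulVec (∑ j, μ j • a j) ≠ 0)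
    -- reality assumptions
    (hA₀real : ∀ i j, (A₀ i j).im = 0)
    (hB₀real : ∀ i j, (B 0 i j).im = 0)
    (hd₀real : ∀ i, (d 0 i).im = 0)
    (hBconj : ∀ l : ℤ, 1 ≤ l → l ≤ (m : ℤ) → B (-l) = (B l).map (starRingEnd ℂ))
    (hdconj : ∀ l : ℤ, 1 ≤ l → l ≤ (m : ℤ) → d (-l) = fun i => (starRingEnd ℂ) (d l i)) :
    ∃ ω₀ : ℝ, 0 < ω₀ ∧ ∀ ω : ℝ, ω₀ < ω →
      ∃ x : ℝ → Fin n → ℂ,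
        (ContDiff ℝ 1 x ∧
         (∀ t : ℝ, x (t + 2 * Real.pi / ω) = x t) ∧
         (∀ t : ℝ, deriv x t =
           (A₀ + ((ω : ℂ))⁻¹ • B 0).mulVec (x t)
           + ∑ l ∈ (Finset.Icc (-(m : ℤ)) (m : ℤ)).erase 0,
               Complex.exp (Complex.I * (l : ℂ) * (ω : ℂ) * (t : ℂ)) •
                 ((B l).mulVec (x t) + d l)
           + d 0)) ∧
        -- the solution is real-valued
        (∀ t : ℝ, ∀ i, (x t i).im = 0) ∧
        -- and it is the unique (2π/ω)-periodic solution
        (∀ x' : ℝ → Fin n → ℂ,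
          (ContDiff ℝ 1 x' ∧
           (∀ t : ℝ, x' (t + 2 * Real.pi / ω) = x' t) ∧
           (∀ t : ℝ, deriv x' t =
             (A₀ + ((ω : ℂ))⁻¹ • B 0).mulVec (x' t)
             + ∑ l ∈ (Finset.Icc (-(m : ℤ)) (m : ℤ)).erase 0,
                 Complex.exp (Complex.I * (l : ℂ) * (ω : ℂ) * (t : ℂ)) •
                   ((B l).mulVec (x' t) + d l)
             + d 0)) → x' = x) := by
  set s' := (Finset.Icc (-(m : ℤ)) (m : ℤ)).erase 0 with hs'
  have hs0 : ∀ l ∈ s', l ≠ 0 := fun l hl => (Finset.mem_erase.mp hl).1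
  have hIl : ∀ l ∈ s', Complex.I * (l : ℂ) ≠ 0 := fun l hl =>
    mul_ne_zero Complex.I_ne_zero (by exact_mod_cast hs0 l hl)
  let P : ℝ → (Fin n → ℂ) →L[ℝ] (Fin n → ℂ) :=
    fun t => ∑ l ∈ s', ((Complex.I * (l : ℂ))⁻¹ * auxE l t) • auxMv (B l)
  let Q : ℝ → (Fin n → ℂ) →L[ℝ] (Fin n → ℂ) :=
    fun t => ∑ l ∈ s', auxE l t • auxMv (B l)
  let f : ℝ → (Fin n → ℂ) := fun t => ∑ l ∈ s', auxE l t • d l + d 0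
  let S : (Fin n → ℂ) →L[ℝ] (Fin n → ℂ) :=
    auxMv (∑ l ∈ s', (Complex.I * (l : ℂ))⁻¹ • (B (-l) * B l))
  let q : ℝ := ∑ l ∈ s', ‖auxMv (B l)‖
  let p : ℝ := ∑ l ∈ s', ‖(Complex.I * (l : ℂ))⁻¹‖ * ‖auxMv (B l)‖
  have hPapp : ∀ t v, P t v = ∑ l ∈ s', auxE l t • ((Complex.I * (l : ℂ))⁻¹ • (B l).mulVec v) := by
    intro t v
    simp only [P, _root_.sum_apply]
    refine Finset.sum_congr rfl fun l _ => ?_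
    rw [smul_smul, mul_comm (auxE l t)]
    rfl
  have hQapp : ∀ t v, Q t v = ∑ l ∈ s', auxE l t • (B l).mulVec v := by
    intro t v
    simp only [Q, _root_.sum_apply]
    rfl
  have hP : ∀ t, HasDerivAt P (Q t) t := by
    intro t
    refine HasDerivAt.fun_sum fun l hl => ?_
    have h1 := ((auxE_deriv l t).const_mul (Complex.I * (l : ℂ))⁻¹).smul_const (auxMv (B l))
    convert h1 using 2
    rw [mul_comm (auxE l t), ← mul_assoc, inv_mul_cancel₀ (hIl l hl), one_mul]
  have hQc : Continuous Q :=
    continuous_finsetSum _ fun l _ => (auxE_cont l).smul continuous_const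
  have hfc : Continuous f :=
    (continuous_finsetSum _ fun l _ => (auxE_cont l).smul continuous_const).add continuous_const
  have hPper : ∀ t, P (t + 2 * Real.pi) = P t := fun t => by simp only [P, auxE_per]
  have hQper : ∀ t, Q (t + 2 * Real.pi) = Q t := fun t => by simp only [Q, auxE_per]
  have hfper : ∀ t, f (t + 2 * Real.pi) = f t := fun t => by simp only [f, auxE_per]
  have hp : ∀ t, ‖P t‖ ≤ p := fun t => by
    refine norm_sum_le_of_le _ fun l _ => ?_
    rw [norm_smul, norm_mul, auxE_norm, mul_one]
  have hq : ∀ t, ‖Q t‖ ≤ q := fun t => by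
    refine norm_sum_le_of_le _ fun l _ => ?_
    rw [norm_smul, auxE_norm, one_mul]
  have hq0 : 0 ≤ q := (norm_nonneg _).trans (hq 0)
  have hint : ∀ (l : ℤ) (v : Fin n → ℂ), IntervalIntegrable (fun t => auxE l t • v)
      MeasureTheory.volume 0 (2 * Real.pi) := fun l v =>
    ((auxE_cont l).smul continuous_const).intervalIntegrable _ _
  have hPm : ∀ v, ∫ t in (0:ℝ)..(2 * Real.pi), P t v = 0 := by
    intro v
    simp only [hPapp]
    rw [intervalIntegral.integral_finsetSum fun l _ => hint l _]
    refine Finset.sum_eq_zero fun l hl => ?_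
    rw [auxE_int_smul, if_neg (hs0 l hl)]
  have hPQ : ∀ v, ∫ t in (0:ℝ)..(2 * Real.pi), P t (Q t v) = -((2 * Real.pi) • S v) := by
    intro v
    have e1 : ∀ t, P t (Q t v) = ∑ l ∈ s', ∑ k ∈ s', auxE (l + k) t •
        ((Complex.I * (l : ℂ))⁻¹ • (B l * B k).mulVec v) := by
      intro t
      rw [hPapp]
      refine Finset.sum_congr rfl fun l _ => ?_
      rw [hQapp, ← Matrix.mulVecLin_apply, map_sum, Finset.smul_sum, Finset.smul_sum]
      refine Finset.sum_congr rfl fun k _ => ?_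
      rw [map_smul, Matrix.mulVecLin_apply, Matrix.mulVec_mulVec, ← auxE_add, smul_smul, smul_smul,
        smul_smul]
      congr 1
      ring
    simp only [e1]
    have hcc : ∀ l : ℤ, Continuous fun t => ∑ k ∈ s', auxE (l + k) t •
        ((Complex.I * (l : ℂ))⁻¹ • (B l * B k).mulVec v) := fun l =>
      continuous_finsetSum _ fun k _ => (auxE_cont _).smul continuous_const
    rw [intervalIntegral.integral_finsetSum fun l _ => (hcc l).intervalIntegrable _ _]
    have e2 : ∀ l ∈ s', ∫ t in (0:ℝ)..(2 * Real.pi), ∑ k ∈ s', auxE (l + k) t •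
        ((Complex.I * (l : ℂ))⁻¹ • (B l * B k).mulVec v) =
        (2 * Real.pi) • ((Complex.I * (l : ℂ))⁻¹ • (B l * B (-l)).mulVec v) := by
      intro l hl
      rw [intervalIntegral.integral_finsetSum fun k _ => hint _ _]
      simp only [auxE_int_smul]
      rw [Finset.sum_eq_single (-l)]
      · simp
      · intro k _ hk
        rw [if_neg]
        omega
      · intro h
        exfalso
        apply h
        simp only [hs', Finset.mem_erase, Finset.mem_Icc] at hl ⊢
        omega
    rw [Finset.sum_congr rfl e2, ← aux_sum_neg, ← Finset.smul_sum, ← smul_neg]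
    congr 1
    simp only [S]
    rw [auxMv_apply, Matrix.sum_mulVec, ← Finset.sum_neg_distrib]
    refine Finset.sum_congr rfl fun l _ => ?_
    rw [Matrix.smul_mulVec, ← neg_smul, neg_neg]
    congr 1
    push_cast
    rw [mul_neg, inv_neg]
  have hnd : ∀ v, v ≠ 0 → auxMv A₀ v = 0 → ∀ x, auxMv A₀ x + (auxMv (B 0) + S) v ≠ 0 := by
    intro v hv hv0 x
    obtain ⟨μ, hμ⟩ := (Submodule.mem_span_range_iff_exists_fun ℂ).mp (ha_span v hv0)
    have hμ0 : μ ≠ 0 := by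
      rintro rfl
      apply hv
      rw [← hμ]
      simp
    have := hnodeg μ hμ0 x
    rw [hμ, hA₁, Matrix.add_mulVec] at this
    exact this
  obtain ⟨ε₀, hε₀, huniq⟩ := aux_unique (auxMv A₀) (auxMv (B 0)) S P Q p q hP hQc hPper hp hq
    hPm hPQ hnd
  let K : ℝ := ‖auxMv A₀‖ + ‖auxMv (B 0)‖ + q
  have hK0 : 0 ≤ K := by positivity
  have hpi := Real.pi_pos
  refine ⟨max 1 (max (1 / ε₀) (4 * Real.pi * K)), by positivity, ?_⟩
  intro ω hω
  simp only [max_lt_iff] at hω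
  obtain ⟨hω1, hωε, hωK⟩ := hω
  have hω0 : 0 < ω := by linarith
  have hωne : ω ≠ 0 := hω0.ne'
  have hεpos : 0 < ω⁻¹ := inv_pos.mpr hω0
  have hε1 : ω⁻¹ ≤ 1 := inv_le_one_of_one_le₀ hω1.le
  have hεlt : ω⁻¹ < ε₀ := by
    rw [inv_lt_comm₀ hω0 hε₀, ← one_div]
    exact hωε
  let L : ℝ → (Fin n → ℂ) →L[ℝ] (Fin n → ℂ) :=
    fun t => auxMv A₀ + ω⁻¹ • auxMv (B 0) + Q t
  have hLapp : ∀ t v, L t v = auxMv A₀ v + ω⁻¹ • auxMv (B 0) v + Q t v := fun t v => rfl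
  have hLc : Continuous L := continuous_const.add hQc
  have hLper : ∀ t, L (t + 2 * Real.pi) = L t := fun t => by simp only [L, hQper]
  have hLK : ∀ t, ‖L t‖ ≤ K := by
    intro t
    refine norm_add₃_le.trans ?_
    have h1 : ‖ω⁻¹ • auxMv (B 0)‖ ≤ ‖auxMv (B 0)‖ := by
      rw [norm_smul, Real.norm_of_nonneg hεpos.le]
      exact mul_le_of_le_one_left (norm_nonneg _) hε1
    have := hq t
    simp only [K]
    linarith
  have hu0 : ∀ u : ℝ → Fin n → ℂ, (∀ t, HasDerivAt u (ω⁻¹ • (L t (u t))) t) →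
      (∀ t, u (t + 2 * Real.pi) = u t) → u = 0 :=
    fun u h1 h2 => huniq ω⁻¹ hεpos hεlt u h1 h2
  obtain ⟨u, hu, huper⟩ := aux_exists L f hLc hfc hLper hfper K ω⁻¹ hLK hεpos
    (by rw [inv_mul_lt_iff₀ hω0]; linarith) hu0
  -- the right-hand side
  have hrhs : ∀ (t : ℝ) (y : Fin n → ℂ),
      (A₀ + ((ω : ℂ))⁻¹ • B 0).mulVec y + ∑ l ∈ s',
        Complex.exp (Complex.I * (l : ℂ) * (ω : ℂ) * (t : ℂ)) • ((B l).mulVec y + d l) + d 0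
      = L (ω * t) y + f (ω * t) := by
    intro t y
    have e1 : ∀ l : ℤ, Complex.exp (Complex.I * (l : ℂ) * (ω : ℂ) * (t : ℂ)) = auxE l (ω * t) := by
      intro l
      rw [auxE]
      congr 1
      push_cast
      ring
    simp only [e1, smul_add, Finset.sum_add_distrib]
    rw [hLapp, hQapp, auxMv_apply, auxMv_apply, Matrix.add_mulVec, Matrix.smul_mulVec]
    have e2 : ω⁻¹ • (B 0).mulVec y = ((ω : ℂ))⁻¹ • (B 0).mulVec y := by
      ext i
      simp
    rw [e2]
    simp only [f]
    abel
  simp only [hrhs]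
  have hC1 : ∀ x : ℝ → Fin n → ℂ, (∀ t, HasDerivAt x (L (ω * t) (x t) + f (ω * t)) t) →
      ContDiff ℝ 1 x ∧ ∀ t, deriv x t = L (ω * t) (x t) + f (ω * t) := by
    intro x hx
    have hxc : Continuous x := continuous_iff_continuousAt.mpr fun t => (hx t).continuousAt
    have hd : ∀ t, deriv x t = L (ω * t) (x t) + f (ω * t) := fun t => (hx t).deriv
    refine ⟨?_, hd⟩
    rw [contDiff_one_iff_deriv]
    refine ⟨fun t => (hx t).differentiableAt, ?_⟩
    rw [funext hd]
    fun_prop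
  have hC2 : ∀ x : ℝ → Fin n → ℂ, ContDiff ℝ 1 x → (∀ t, deriv x t = L (ω * t) (x t) + f (ω * t)) →
      ∀ t, HasDerivAt x (L (ω * t) (x t) + f (ω * t)) t := by
    intro x hx h t
    rw [← h t]
    exact ((hx.differentiable (by norm_num)) t).hasDerivAt
  have huq : ∀ x x' : ℝ → Fin n → ℂ, (∀ t, HasDerivAt x (L (ω * t) (x t) + f (ω * t)) t) →
      (∀ t, HasDerivAt x' (L (ω * t) (x' t) + f (ω * t)) t) →
      (∀ t : ℝ, x (t + 2 * Real.pi / ω) = x t) → (∀ t : ℝ, x' (t + 2 * Real.pi / ω) = x' t) →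
      x' = x := by
    intro x x' hx hx' hxp hxp'
    have hz := hu0 (fun θ => x' (ω⁻¹ * θ) - x (ω⁻¹ * θ)) (fun θ => by
        have hm : HasDerivAt (fun θ : ℝ => ω⁻¹ * θ) ω⁻¹ θ := by
          simpa using (hasDerivAt_id θ).const_mul ω⁻¹
        have h1 := (hx (ω⁻¹ * θ)).scomp θ hm
        have h2 := (hx' (ω⁻¹ * θ)).scomp θ hm
        have h3 := h2.sub h1
        rw [← smul_sub, add_sub_add_right_eq_sub, ← map_sub, mul_inv_cancel_left₀ hωne] at h3
        exact h3) (fun θ => by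
        have e : ω⁻¹ * (θ + 2 * Real.pi) = ω⁻¹ * θ + 2 * Real.pi / ω := by
          field_simp
        simp only [e, hxp, hxp'])
    ext1 t
    have := congrFun hz (ω * t)
    simp only [inv_mul_cancel_left₀ hωne, Pi.zero_apply] at this
    exact sub_eq_zero.mp this
  have hsolx : ∀ t, HasDerivAt (fun t => u (ω * t)) (L (ω * t) (u (ω * t)) + f (ω * t)) t := by
    intro t
    have hm : HasDerivAt (fun t : ℝ => ω * t) ω t := by
      simpa using (hasDerivAt_id t).const_mul ω
    have h1 := (hu (ω * t)).scomp t hm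
    rw [smul_smul, mul_inv_cancel₀ hωne, one_smul] at h1
    exact h1
  have hperx : ∀ t : ℝ, u (ω * (t + 2 * Real.pi / ω)) = u (ω * t) := by
    intro t
    have e : ω * (t + 2 * Real.pi / ω) = ω * t + 2 * Real.pi := by field_simp
    rw [e, huper]
  -- conjugation symmetry
  have hBc : ∀ l ∈ s', (B l).map (starRingEnd ℂ) = B (-l) := by
    intro l hl
    simp only [hs', Finset.mem_erase, Finset.mem_Icc] at hl
    rcases lt_or_gt_of_ne hl.1 with h | h
    · have := hBconj (-l) (by omega) (by omega)
      rw [neg_neg] at this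
      rw [this]
      ext i j
      simp
    · exact (hBconj l (by omega) (by omega)).symm
  have hdc : ∀ l ∈ s', star (d l) = d (-l) := by
    intro l hl
    simp only [hs', Finset.mem_erase, Finset.mem_Icc] at hl
    rcases lt_or_gt_of_ne hl.1 with h | h
    · have := hdconj (-l) (by omega) (by omega)
      rw [neg_neg] at this
      rw [this]
      ext i
      simp
    · exact (hdconj l (by omega) (by omega)).symm
  have hA0c : A₀.map (starRingEnd ℂ) = A₀ := by
    ext i j
    exact Complex.conj_eq_iff_im.mpr (hA₀real i j)
  have hB0c : (B 0).map (starRingEnd ℂ) = B 0 := by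
    ext i j
    exact Complex.conj_eq_iff_im.mpr (hB₀real i j)
  have hd0c : star (d 0) = d 0 := by
    ext i
    exact Complex.conj_eq_iff_im.mpr (hd₀real i)
  have hstar : ∀ θ v, star (L θ v + f θ) = L θ (star v) + f θ := by
    intro θ v
    have h1 : star (Q θ v) = Q θ (star v) := by
      rw [hQapp, hQapp, star_sum, ← aux_sum_neg m (fun l => auxE l θ • (B l).mulVec (star v))]
      refine Finset.sum_congr rfl fun l hl => ?_
      rw [star_smul, aux_star_mulVec, hBc l hl, auxE_star]
    have h2 : star (f θ) = f θ := by
      simp only [f]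
      rw [star_add, hd0c, star_sum, ← aux_sum_neg m (fun l => auxE l θ • d l)]
      congr 1
      refine Finset.sum_congr rfl fun l hl => ?_
      rw [star_smul, hdc l hl, auxE_star]
    rw [star_add, h2, hLapp, hLapp, star_add, star_add, h1, star_smul, auxMv_apply, auxMv_apply,
      auxMv_apply, auxMv_apply, aux_star_mulVec, aux_star_mulVec, hA0c, hB0c]
    simp
  have hconj := huq (fun t => u (ω * t)) (fun t => star (u (ω * t))) hsolx (fun t => by
      have := (hsolx t).star
      rw [hstar] at this
      exact this) hperx (fun t => by rw [hperx])
  obtain ⟨hcd, hde⟩ := hC1 _ hsolx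
  refine ⟨fun t => u (ω * t), ⟨hcd, hperx, hde⟩, ?_, ?_⟩
  · intro t i
    exact Complex.conj_eq_iff_im.mp (congrFun (congrFun hconj t) i)
  · rintro x' ⟨h1, h2, h3⟩
    exact huq _ _ hsolx (hC2 x' h1 h3) hperx h2
end
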